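/- arXiv:2101.04029 — 2 statements merged into one kernel-verified Lean document; each statement's English description precedes it below -/
import Mathlib

section
/- Let d ≥ 1 and l ∈ ℤ_{≥0}^d. Then for every δ ∈ (0,∞)^d and x⁰ ∈ ℝ^d, with Q = ∏_{j=1}^d (x⁰_j, x⁰_j + δ_j), there exists a unique linear operator P = P^{d,l}_{δ,x⁰} : L₁(Q) → 𝒫^{d,l} such that (1) P(f|_Q) = f for every f ∈ 𝒫^{d,l}, and (2) ker P = { f ∈ L₁(Q) : ∫_Q f·g dx = 0 for all g ∈ 𝒫^{d,l} }. Moreover there exist constants c₂ = c₂(d,l) > 0 and c₃ = c₃(d,l) > 0, independent of δ and x⁰, such that (3) for every 1 ≤ p ≤ ∞ and f ∈ L_p(Q): ‖P f‖_{L_p(Q)} ≤ c₂ ‖f‖_{L_p(Q)}, and (4) for every 1 ≤ p < ∞ and f ∈ L_p(Q): ‖f − P f‖_{L_p(Q)} ≤ c₃ ∑_{j=1}^d δ_j^{−1/p} ( ∫_{−δ_j}^{δ_j} ∫_{Q_{(l_j+1)ξ e_j}} |(Δ_{ξ e_j}^{l_j+1} f)(x)|^p dx dξ )^{1/p}. 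-/
open MeasureTheory Set Function
open scoped ENNReal NNReal BigOperators Classical

noncomputable section

namespace NBExt

variable {d : ℕ}

/-- The space `𝒫^{d,l}` of real polynomials of degree at most `l j` in the `j`-th variable. -/
def IsPolyDeg (l : Fin d → ℕ) (f : (Fin d → ℝ) → ℝ) : Prop :=
  ∃ a : (∀ j : Fin d, Fin (l j + 1)) → ℝ,
    ∀ x, f x = ∑ k : (∀ j : Fin d, Fin (l j + 1)), a k * ∏ j, x j ^ (k j : ℕ)

/-- Real polynomials of one variable of degree at most `k`. -/
def IsPolyDeg1 (k : ℕ) (g : ℝ → ℝ) : Prop :=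
  ∃ a : Fin (k + 1) → ℝ, ∀ x, g x = ∑ i : Fin (k + 1), a i * x ^ (i : ℕ)

/-- Mixed difference `Δ_h^l f` of order `l` with step `h`. -/
def mixedDiff (l : Fin d → ℕ) (h : Fin d → ℝ) (f : (Fin d → ℝ) → ℝ) : (Fin d → ℝ) → ℝ :=
  fun x => ∑ k : (∀ j : Fin d, Fin (l j + 1)),
    ((-1 : ℝ) ^ (∑ j, (l j - (k j : ℕ)))) * (∏ j, ((l j).choose (k j) : ℝ)) *
      f (fun j => x j + (k j : ℕ) * h j)

/-- The set `D_h^l = {x ∈ D : x + ∑_j t_j l_j h_j e_j ∈ D ∀ t ∈ [0,1]^d}`. -/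
def diffDomain (D : Set (Fin d → ℝ)) (l : Fin d → ℕ) (h : Fin d → ℝ) : Set (Fin d → ℝ) :=
  {x | x ∈ D ∧ ∀ t : Fin d → ℝ, (∀ j, t j ∈ Icc (0:ℝ) 1) →
    (fun j => x j + t j * (l j : ℝ) * h j) ∈ D}

/-- The averaged mixed modulus of continuity `Ω′^l (f, t)_{L_p(D)}` (only the coordinates
`t j` with `l j ≠ 0` are relevant; the remaining coordinates of the integration variable
are dummy variables ranging over a set of measure `1`). -/
def avgModulus (p : ℝ) (D : Set (Fin d → ℝ)) (l : Fin d → ℕ) (f : (Fin d → ℝ) → ℝ)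
    (t : Fin d → ℝ) : ℝ≥0∞ :=
  ((∏ j, if l j = 0 then 1 else ENNReal.ofReal (2 * t j))⁻¹ *
    ∫⁻ ξ in Set.univ.pi (fun j => if l j = 0 then Icc (0:ℝ) 1 else Icc (-(t j)) (t j)),
      (eLpNorm (mixedDiff l ξ f) (ENNReal.ofReal p) (volume.restrict (diffDomain D l ξ))) ^ p)
    ^ (1 / p)

/-- The mixed modulus of continuity `Ω^l (f, t)_{L_p(D)}` (essential supremum over steps). -/
def supModulus (p : ℝ) (D : Set (Fin d → ℝ)) (l : Fin d → ℕ) (f : (Fin d → ℝ) → ℝ)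
    (t : Fin d → ℝ) : ℝ≥0∞ :=
  essSup (fun h : Fin d → ℝ =>
      eLpNorm (mixedDiff l h f) (ENNReal.ofReal p) (volume.restrict (diffDomain D l h)))
    (volume.restrict {h : Fin d → ℝ | ∀ j, l j ≠ 0 → |h j| ≤ t j})

/-- The multi-index `l · χ_J`. -/
def indicatorIdx (J : Finset (Fin d)) (l : Fin d → ℕ) : Fin d → ℕ :=
  fun j => if j ∈ J then l j else 0

/-- `l(α) j = min {n ∈ ℕ : α j < n}` (for `α j > 0`). -/
def lOf (α : Fin d → ℝ) : Fin d → ℕ := fun j => ⌊α j⌋₊ + 1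

/-- The `J`-th seminorm of the space `(S_{p,θ}^α B)′(D)`, `θ < ∞`; coordinates of the
integration variable outside `J` are dummy variables ranging over `(0,1)`. -/
def besovPrimeSemi (p θ : ℝ) (α : Fin d → ℝ) (D : Set (Fin d → ℝ)) (f : (Fin d → ℝ) → ℝ)
    (J : Finset (Fin d)) : ℝ≥0∞ :=
  (∫⁻ t in Set.univ.pi (fun j => if j ∈ J then Ioi (0:ℝ) else Ioo (0:ℝ) 1),
      (∏ j ∈ J, ENNReal.ofReal ((t j) ^ (-1 - θ * α j))) *
        (avgModulus p D (indicatorIdx J (lOf α)) f t) ^ θ) ^ (1 / θ)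

/-- The `J`-th seminorm of the space `(S_p^α H)′(D)`. -/
def nikolskiiPrimeSemi (p : ℝ) (α : Fin d → ℝ) (D : Set (Fin d → ℝ)) (f : (Fin d → ℝ) → ℝ)
    (J : Finset (Fin d)) : ℝ≥0∞ :=
  ⨆ t ∈ {t : Fin d → ℝ | ∀ j ∈ J, 0 < t j},
    (∏ j ∈ J, ENNReal.ofReal ((t j) ^ (-(α j)))) * avgModulus p D (indicatorIdx J (lOf α)) f t

/-- The norm of `(S_{p,θ}^α B)′(D)` for `1 ≤ θ ≤ ∞`, with the convention
`(S_{p,∞}^α B)′(D) = (S_p^α H)′(D)`. -/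
def besovPrimeNorm (p : ℝ) (θ : ℝ≥0∞) (α : Fin d → ℝ) (D : Set (Fin d → ℝ))
    (f : (Fin d → ℝ) → ℝ) : ℝ≥0∞ :=
  max (eLpNorm f (ENNReal.ofReal p) (volume.restrict D))
    (⨆ J : Finset (Fin d), ⨆ _ : J.Nonempty,
      if θ = ∞ then nikolskiiPrimeSemi p α D f J else besovPrimeSemi p θ.toReal α D f J)

/-- The `J`-th seminorm of the space `(S_{p,θ}^α B)^lsm(D)`, `θ < ∞`, evaluated on the weak
derivative `g = D^{lsm χ_J} f`. -/
def besovSmoothSemi (p θ : ℝ) (α : Fin d → ℝ) (lsm : Fin d → ℕ) (D : Set (Fin d → ℝ))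
    (g : (Fin d → ℝ) → ℝ) (J : Finset (Fin d)) : ℝ≥0∞ :=
  (∫⁻ t in Set.univ.pi (fun j => if j ∈ J then Ioi (0:ℝ) else Ioo (0:ℝ) 1),
      (∏ j ∈ J, ENNReal.ofReal ((t j) ^ (-1 - θ * (α j - (lsm j : ℝ))))) *
        (supModulus p D (indicatorIdx J (fun j => lOf α j - lsm j)) g t) ^ θ) ^ (1 / θ)

/-- The `J`-th seminorm of the space `(S_p^α H)^lsm(D)`. -/
def nikolskiiSmoothSemi (p : ℝ) (α : Fin d → ℝ) (lsm : Fin d → ℕ) (D : Set (Fin d → ℝ))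
    (g : (Fin d → ℝ) → ℝ) (J : Finset (Fin d)) : ℝ≥0∞ :=
  ⨆ t ∈ {t : Fin d → ℝ | ∀ j ∈ J, 0 < t j},
    (∏ j ∈ J, ENNReal.ofReal ((t j) ^ (-(α j - (lsm j : ℝ))))) *
      supModulus p D (indicatorIdx J (fun j => lOf α j - lsm j)) g t

/-- The norm of `(S_{p,θ}^α B)^lsm(D)` for `1 ≤ θ ≤ ∞`, computed from a family `g J` of weak
derivatives `D^{lsm χ_J} f`. -/
def besovSmoothNorm (p : ℝ) (θ : ℝ≥0∞) (α : Fin d → ℝ) (lsm : Fin d → ℕ)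
    (D : Set (Fin d → ℝ)) (f : (Fin d → ℝ) → ℝ)
    (g : Finset (Fin d) → (Fin d → ℝ) → ℝ) : ℝ≥0∞ :=
  max (eLpNorm f (ENNReal.ofReal p) (volume.restrict D))
    (⨆ J : Finset (Fin d), ⨆ _ : J.Nonempty,
      if θ = ∞ then nikolskiiSmoothSemi p α lsm D (g J) J
      else besovSmoothSemi p θ.toReal α lsm D (g J) J)

/-- Partial derivative in the `j`-th coordinate direction. -/
def pderiv (j : Fin d) (f : (Fin d → ℝ) → ℝ) : (Fin d → ℝ) → ℝ :=
  fun x => fderiv ℝ f x (Pi.single j 1)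

/-- The mixed partial derivative `∂^λ`. -/
def mixedPartial (lam : Fin d → ℕ) (f : (Fin d → ℝ) → ℝ) : (Fin d → ℝ) → ℝ :=
  ((List.finRange d).foldr (fun j F => (pderiv j)^[lam j] ∘ F) id) f

/-- `g` is the weak derivative `D^λ f` on the open set `D`. -/
def HasWeakDeriv (D : Set (Fin d → ℝ)) (lam : Fin d → ℕ) (f g : (Fin d → ℝ) → ℝ) : Prop :=
  ∀ φ : (Fin d → ℝ) → ℝ, ContDiff ℝ (⊤ : ℕ∞) φ → HasCompactSupport φ → tsupport φ ⊆ D →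
    ∫ x in D, f x * mixedPartial lam φ x = (-1 : ℝ) ^ (∑ j, lam j) * ∫ x in D, g x * φ x

/-- `Pf` is the orthogonal projection (in the `L₂(Q)` pairing) of `f` onto `𝒫^{d,l}`. -/
def IsOrthProj (l : Fin d → ℕ) (Q : Set (Fin d → ℝ)) (f Pf : (Fin d → ℝ) → ℝ) : Prop :=
  IsPolyDeg l Pf ∧ ∀ g, IsPolyDeg l g → ∫ x in Q, (f x - Pf x) * g x = 0

/-- The polynomial projection `P^{d,l}_{δ,x0} f` (for `Q` the corresponding box);
equal to `0` if no projection exists (e.g. if `f` is not integrable on `Q`). -/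
def projPoly (l : Fin d → ℕ) (Q : Set (Fin d → ℝ)) (f : (Fin d → ℝ) → ℝ) :
    (Fin d → ℝ) → ℝ :=
  if h : ∃ Pf, IsOrthProj l Q f Pf then h.choose else 0

/-- One-dimensional version of `IsOrthProj`. -/
def IsOrthProj1 (k : ℕ) (I : Set ℝ) (g Pg : ℝ → ℝ) : Prop :=
  IsPolyDeg1 k Pg ∧ ∀ q, IsPolyDeg1 k q → ∫ x in I, (g x - Pg x) * q x = 0

/-- One-dimensional polynomial projection `P^{1,k}_{δ,a}` on the interval `I = (a, a+δ)`. -/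
def projPoly1 (k : ℕ) (I : Set ℝ) (g : ℝ → ℝ) : ℝ → ℝ :=
  if h : ∃ Pg, IsOrthProj1 k I g Pg then h.choose else 0

/-- Apply a one-dimensional operator `T` to the `j`-th coordinate slices of `f`
(the pointwise realization of the tensorization `V_j(T)`). -/
def applySlice (j : Fin d) (T : (ℝ → ℝ) → (ℝ → ℝ)) (f : (Fin d → ℝ) → ℝ) :
    (Fin d → ℝ) → ℝ :=
  fun x => T (fun s => f (Function.update x j s)) (x j)

/-- The composition `∏_{j ∈ js} V_j(T j)` applied slice-wise. -/
def applySlices (js : List (Fin d)) (T : Fin d → (ℝ → ℝ) → (ℝ → ℝ))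
    (f : (Fin d → ℝ) → ℝ) : (Fin d → ℝ) → ℝ :=
  js.foldr (fun j acc => applySlice j (T j) acc) f

/-- The open box `x0 + δ·I^d`. -/
def box (x0 δ : Fin d → ℝ) : Set (Fin d → ℝ) :=
  Set.univ.pi fun j => Ioo (x0 j) (x0 j + δ j)

/-- The one-dimensional operator `M_{χ_{(A,A+Δ)}} ∘ P^{1,k}_{δ,a}`. -/
def cutProj1 (k : ℕ) (a δ A Δ : ℝ) : (ℝ → ℝ) → (ℝ → ℝ) :=
  fun g => (Ioo A (A + Δ)).indicator (projPoly1 k (Ioo a (a + δ)) g)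

/-- The one-dimensional operator `E - M_{χ_{(A,A+Δ)}} ∘ P^{1,k}_{δ,a}`. -/
def oneMinusCutProj1 (k : ℕ) (a δ A Δ : ℝ) : (ℝ → ℝ) → (ℝ → ℝ) :=
  fun g s => g s - cutProj1 k a δ A Δ g s

/-- The predicate characterizing the projector `P^{d,l}_{δ,x0}` (as an operator defined on
`L₁` of the box `Q`): it is linear, maps into `𝒫^{d,l}`, fixes polynomials, has the stated
kernel, and is well defined on `L₁(Q)`. -/
def ProjPred (l : Fin d → ℕ) (Q : Set (Fin d → ℝ))
    (P : ((Fin d → ℝ) → ℝ) → ((Fin d → ℝ) → ℝ)) : Prop :=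
  (∀ f, IntegrableOn f Q volume → IsPolyDeg l (P f)) ∧
  (∀ f, IsPolyDeg l f → P f = f) ∧
  (∀ f, IntegrableOn f Q volume →
    (P f = 0 ↔ ∀ g, IsPolyDeg l g → ∫ x in Q, f x * g x = 0)) ∧
  (∀ f g, IntegrableOn f Q volume → IntegrableOn g Q volume → P (f + g) = P f + P g) ∧
  (∀ (c : ℝ) f, IntegrableOn f Q volume → P (c • f) = c • P f) ∧
  (∀ f g, IntegrableOn f Q volume → IntegrableOn g Q volume →
    f =ᵐ[volume.restrict Q] g → P f = P g)

/-- The cardinal B-spline `ψ^{1,m}` of order `m+1`. -/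
def bspline : ℕ → ℝ → ℝ
  | 0 => (Ioo (0:ℝ) 1).indicator 1
  | m + 1 => fun x => ∫ y in (0:ℝ)..1, bspline m (x - y)

/-- The tensor-product B-spline `g_{κ,ν}^{d,m}(x) = ψ^{d,m}(2^κ x - ν)`. -/
def gfun (m κ : Fin d → ℕ) (ν : Fin d → ℤ) : (Fin d → ℝ) → ℝ :=
  fun x => ∏ j, bspline (m j) ((2:ℝ) ^ (κ j) * x j - (ν j : ℝ))

/-- The dyadic cube `Q_{κ,ν}^d`. -/
def dyadicCube (κ : Fin d → ℕ) (ν : Fin d → ℤ) : Set (Fin d → ℝ) :=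
  Set.univ.pi fun j => Ioo ((ν j : ℝ) / 2 ^ (κ j)) (((ν j : ℝ) + 1) / 2 ^ (κ j))

/-- The index set `N_κ^{d,m,D}`. -/
def indexSet (m : Fin d → ℕ) (D : Set (Fin d → ℝ)) (κ : Fin d → ℕ) : Set (Fin d → ℤ) :=
  {ν | (tsupport (gfun m κ ν) ∩ D).Nonempty}

/-- The approximation operator `E_κ^{d,r,m,D}` built from a selection map `νmap`. -/
def Eop (r m : Fin d → ℕ) (D : Set (Fin d → ℝ)) (κ : Fin d → ℕ)
    (νmap : (Fin d → ℤ) → (Fin d → ℤ)) (f : (Fin d → ℝ) → ℝ) : (Fin d → ℝ) → ℝ :=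
  fun x => ∑' ν : indexSet m D κ,
    projPoly r (dyadicCube κ (νmap (ν : Fin d → ℤ))) f x * gfun m κ (ν : Fin d → ℤ) x

/-- The set `M_ε^m(ν)` of admissible shifts (encoded with value `0` outside `σ(ε) = S`). -/
def Mset (m : Fin d → ℕ) (S : Finset (Fin d)) (ν : Fin d → ℤ) :
    Finset (∀ j : Fin d, Fin (m j + 2)) :=
  Finset.univ.filter fun ms =>
    ∀ j, (j ∈ S → (2 : ℤ) ∣ (ν j - ((ms j : ℕ) : ℤ))) ∧ (j ∉ S → (ms j : ℕ) = 0)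

/-- The index `n_ε(ν,ms)`. -/
def nEps (m : Fin d → ℕ) (S : Finset (Fin d)) (ν : Fin d → ℤ)
    (ms : ∀ j : Fin d, Fin (m j + 2)) : Fin d → ℤ :=
  fun j => if j ∈ S then (ν j - ((ms j : ℕ) : ℤ)) / 2 else ν j

/-- The coefficient `A_ms^m = ∏_{j ∈ S} 2^{-m_j} C_{m_j+1}^{ms_j}`. -/
def coefA (m : Fin d → ℕ) (S : Finset (Fin d)) (ms : ∀ j : Fin d, Fin (m j + 2)) : ℝ :=
  ∏ j ∈ S, ((m j + 1).choose (ms j) : ℝ) / 2 ^ (m j)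

/-- `κ - ε` where `ε = χ_S`. -/
def subLevel (κ : Fin d → ℕ) (S : Finset (Fin d)) : Fin d → ℕ :=
  fun j => κ j - (if j ∈ S then 1 else 0)

/-- The polynomial coefficient `U_{K0+κ,ν}^{d,r,m,D} f`. -/
def Uop (r m K0 : Fin d → ℕ) (νmap : (Fin d → ℕ) → (Fin d → ℤ) → (Fin d → ℤ))
    (κ : Fin d → ℕ) (ν : Fin d → ℤ) (f : (Fin d → ℝ) → ℝ) : (Fin d → ℝ) → ℝ :=
  ∑ S ∈ Finset.univ.filter (fun S : Finset (Fin d) => ∀ j ∈ S, κ j ≠ 0),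
    ∑ ms ∈ Mset m S ν,
      ((-1 : ℝ) ^ S.card * coefA m S ms) •
        projPoly r (dyadicCube (fun j => K0 j + subLevel κ S j)
          (νmap (subLevel κ S) (nEps m S ν ms))) f

/-- The approximation operator `ℰ_{K0,κ}^{d,r,m,D}`. -/
def curlyE (r m K0 : Fin d → ℕ) (D : Set (Fin d → ℝ))
    (νmap : (Fin d → ℕ) → (Fin d → ℤ) → (Fin d → ℤ)) (κ : Fin d → ℕ)
    (f : (Fin d → ℝ) → ℝ) : (Fin d → ℝ) → ℝ :=
  fun x => ∑' ν : indexSet m D (fun j => K0 j + κ j),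
    Uop r m K0 νmap κ (ν : Fin d → ℤ) f x * gfun m (fun j => K0 j + κ j) (ν : Fin d → ℤ) x

/-- The open axis-parallel box spanned by two dyadic cubes. -/
def spanBox (κ₁ : Fin d → ℕ) (ν₁ : Fin d → ℤ) (κ₂ : Fin d → ℕ) (ν₂ : Fin d → ℤ) :
    Set (Fin d → ℝ) :=
  Set.univ.pi fun j =>
    Ioo (min ((ν₁ j : ℝ) / 2 ^ (κ₁ j)) ((ν₂ j : ℝ) / 2 ^ (κ₂ j)))
        (max (((ν₁ j : ℝ) + 1) / 2 ^ (κ₁ j)) (((ν₂ j : ℝ) + 1) / 2 ^ (κ₂ j)))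

/-- `D` is a (bounded) domain of `m`-type with data `K0, G0, νmap, nmap`. -/
def IsMType (m : Fin d → ℕ) (D : Set (Fin d → ℝ)) (K0 : Fin d → ℕ) (G0 : Fin d → ℝ)
    (νmap nmap : (Fin d → ℕ) → (Fin d → ℤ) → (Fin d → ℤ)) : Prop :=
  (∀ j, 0 < G0 j) ∧
  (∀ κ : Fin d → ℕ, ∀ ν ∈ indexSet m D (fun j => K0 j + κ j),
    (dyadicCube (fun j => K0 j + κ j) (νmap κ ν) ∪
     dyadicCube (fun j => K0 j + κ j) (nmap κ ν)) ⊆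
      D ∩ Set.univ.pi (fun j =>
        Icc (((ν j : ℝ) - G0 j) / 2 ^ (K0 j + κ j)) (((ν j : ℝ) + G0 j) / 2 ^ (K0 j + κ j)))) ∧
  (∀ κ : Fin d → ℕ, ∀ ν ∈ indexSet m D (fun j => K0 j + κ j),
    ∀ S : Finset (Fin d), (∀ j ∈ S, κ j ≠ 0) → ∀ ms ∈ Mset m S ν,
      spanBox (fun j => K0 j + κ j) (nmap κ ν)
        (fun j => K0 j + subLevel κ S j) (νmap (subLevel κ S) (nEps m S ν ms)) ⊆ D) ∧
  (∀ κ : Fin d → ℕ, ∀ ν ∈ indexSet m D (fun j => K0 j + κ j),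
    ∀ S : Finset (Fin d), (∀ j ∈ S, κ j ≠ 0) → ∀ ms ∈ Mset m S ν, ∀ j ∉ S,
      νmap (subLevel κ S) (nEps m S ν ms) j = νmap κ ν j)

/-- `D` is a bounded domain. -/
def IsBoundedDomain (D : Set (Fin d → ℝ)) : Prop :=
  IsOpen D ∧ IsConnected D ∧ Bornology.IsBounded D

end NBExt

namespace NBExt

/-- one-dimensional difference -/
def dif (k : ℕ) (ξ : ℝ) (φ : ℝ → ℝ) (x : ℝ) : ℝ :=
  ∑ i ∈ Finset.range (k + 1), (-1 : ℝ) ^ (k - i) * (k.choose i : ℝ) * φ (x + i * ξ)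

lemma dif_eq_fwdDiff (k : ℕ) (ξ : ℝ) (φ : ℝ → ℝ) (x : ℝ) :
    dif k ξ φ x = (fwdDiff ξ)^[k] φ x := by
  rw [fwdDiff_iter_eq_sum_shift, dif]
  refine Finset.sum_congr rfl fun i _ => ?_
  simp [nsmul_eq_mul]

/-- affine change of variables inequality -/
lemma lint_chg (F : ℝ → ℝ≥0∞) (c e : ℝ) (hc : c ≠ 0) (S T : Set ℝ) (hS : MeasurableSet S)
    (hT : MeasurableSet T) (h : ∀ x ∈ S, c * x + e ∈ T) :
    ∫⁻ x in S, F (c * x + e) ≤ ENNReal.ofReal |c⁻¹| * ∫⁻ y in T, F y := by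
  rw [← lintegral_indicator hS, ← lintegral_indicator hT]
  have h1 : ∀ x, S.indicator (fun x => F (c * x + e)) x ≤ (T.indicator F) (c * x + e) := by
    intro x
    by_cases hx : x ∈ S
    · rw [indicator_of_mem hx, indicator_of_mem (h x hx)]
    · rw [indicator_of_notMem hx]; exact zero_le
  refine (lintegral_mono h1).trans (le_of_eq ?_)
  have h2 := (Homeomorph.mulLeft₀ c hc).toMeasurableEquiv.measurableEmbedding.lintegral_map
    (μ := volume) (fun y => T.indicator F (y + e))
  have h3 : Measure.map (Homeomorph.mulLeft₀ c hc).toMeasurableEquiv volume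
      = ENNReal.ofReal |c⁻¹| • (volume : Measure ℝ) := Real.map_volume_mul_left hc
  rw [h3, lintegral_smul_measure, lintegral_add_right_eq_self (T.indicator F) e, smul_eq_mul] at h2
  exact h2.symm

/-- Steklov average -/
def av (h : ℝ) (g : ℝ → ℝ) (s : ℝ) : ℝ := ∫ t in (0:ℝ)..1, g (s + h * t)

lemma av_cont (h : ℝ) (g : ℝ → ℝ) (hg : Continuous g) : Continuous (av h g) := by
  unfold av
  apply intervalIntegral.continuous_parametric_intervalIntegral_of_continuous' (by fun_prop)

lemma av_iter_cont (h : ℝ) (g : ℝ → ℝ) (hg : Continuous g) (k : ℕ) :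
    Continuous ((av h)^[k] g) := by
  induction k generalizing g with
  | zero => simpa
  | succ k ih => rw [iterate_succ_apply]; exact ih _ (av_cont h g hg)

lemma av_bound (h c : ℝ) (hh : 0 ≤ h) (g : ℝ → ℝ) (hg : Continuous g) :
    ∫⁻ s in Ioo 0 c, ‖av h g s‖ₑ ≤ ∫⁻ s in Ioo 0 (c + h), ‖g s‖ₑ := by
  have h1 : ∀ s, ‖av h g s‖ₑ ≤ ∫⁻ t in Ioc (0:ℝ) 1, ‖g (s + h * t)‖ₑ := by
    intro s
    unfold av
    rw [intervalIntegral.integral_of_le zero_le_one]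
    exact enorm_integral_le_lintegral_enorm _
  calc ∫⁻ s in Ioo 0 c, ‖av h g s‖ₑ ≤ ∫⁻ s in Ioo 0 c, ∫⁻ t in Ioc (0:ℝ) 1, ‖g (s + h * t)‖ₑ :=
        lintegral_mono h1
    _ = ∫⁻ t in Ioc (0:ℝ) 1, ∫⁻ s in Ioo 0 c, ‖g (s + h * t)‖ₑ := by
        apply lintegral_lintegral_swap
        apply Measurable.aemeasurable
        have : Continuous fun q : ℝ × ℝ => g (q.1 + h * q.2) := by fun_prop
        exact this.measurable.enorm
    _ ≤ ∫⁻ t in Ioc (0:ℝ) 1, ∫⁻ s in Ioo 0 (c + h), ‖g s‖ₑ := by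
        apply setLIntegral_mono' measurableSet_Ioc
        intro t ht
        have := lint_chg (fun s => ‖g s‖ₑ) 1 (h * t) one_ne_zero (Ioo 0 c) (Ioo 0 (c + h))
          measurableSet_Ioo measurableSet_Ioo (by
            intro x hx
            have h3 : h * t ≤ h := by nlinarith [ht.2]
            have h4 : 0 ≤ h * t := mul_nonneg hh ht.1.le
            constructor <;> linarith [hx.1, hx.2])
        simpa using this
    _ = _ := by simp

lemma av_iter_bound (h c : ℝ) (hh : 0 ≤ h) (k : ℕ) (g : ℝ → ℝ) (hg : Continuous g) :
    ∫⁻ s in Ioo 0 c, ‖(av h)^[k] g s‖ₑ ≤ ∫⁻ s in Ioo 0 (c + k * h), ‖g s‖ₑ := by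
  induction k generalizing c with
  | zero => simp
  | succ k ih =>
    rw [iterate_succ_apply']
    refine (av_bound h c hh _ (av_iter_cont h g hg k)).trans ((ih _).trans (le_of_eq ?_))
    congr 3
    push_cast; ring

lemma av_iter_sum (h : ℝ) (k : ℕ) {ι : Type*} (s : Finset ι) (c : ι → ℝ) (g : ι → ℝ → ℝ)
    (hg : ∀ i ∈ s, Continuous (g i)) :
    (av h)^[k] (fun x => ∑ i ∈ s, c i * g i x) = fun x => ∑ i ∈ s, c i * (av h)^[k] (g i) x := by
  induction k with
  | zero => rfl
  | succ k ih =>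
    rw [iterate_succ_apply', ih]
    funext x
    unfold av
    rw [intervalIntegral.integral_finsetSum]
    · refine Finset.sum_congr rfl fun i hi => ?_
      rw [intervalIntegral.integral_const_mul, iterate_succ_apply']
    · intro i hi
      apply Continuous.intervalIntegrable
      have := av_iter_cont h _ (hg i hi) k
      unfold av at this
      fun_prop

lemma av_iter_deriv (h : ℝ) (hh : h ≠ 0) (k : ℕ) (g : ℝ → ℝ) (hg : ContDiff ℝ (⊤ : ℕ∞) g) :
    (av h)^[k] (iteratedDeriv k g) = fun s => (h ^ k)⁻¹ * (fwdDiff h)^[k] g s := by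
  induction k generalizing g with
  | zero => funext s; simp
  | succ k ih =>
    have hd : ContDiff ℝ (⊤ : ℕ∞) (iteratedDeriv k g) := by
      exact hg.iterate_deriv k |> fun h => by rwa [← iteratedDeriv_eq_iterate] at h
    have h1 : av h (iteratedDeriv (k + 1) g) = fun s => h⁻¹ * iteratedDeriv k (fwdDiff h g) s := by
      funext s
      have e1 : iteratedDeriv k (fwdDiff h g) s = iteratedDeriv k g (s + h) - iteratedDeriv k g s := by
        have : fwdDiff h g = (fun x => g (x + h)) - g := by funext x; rfl
        rw [this, iteratedDeriv_sub, iteratedDeriv_comp_add_const]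
        · exact ((hg.comp (contDiff_id.add contDiff_const)).of_le (by exact_mod_cast le_top)).contDiffAt
        · exact (hg.of_le (by exact_mod_cast le_top)).contDiffAt
      rw [e1]
      unfold av
      have h2 := intervalIntegral.integral_comp_add_mul (a := 0) (b := 1)
        (iteratedDeriv (k + 1) g) hh s
      rw [h2, iteratedDeriv_succ, intervalIntegral.integral_deriv_eq_sub]
      · simp
      · intro x _
        exact (hd.differentiable (by simp)).differentiableAt
      · apply Continuous.intervalIntegrable
        exact hd.continuous_deriv (by simp)
    rw [iterate_succ_apply, h1]
    have h4 : ContDiff ℝ (⊤ : ℕ∞) (fwdDiff h g) := by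
      unfold fwdDiff
      exact (hg.comp (contDiff_id.add contDiff_const)).sub hg
    have h3 := av_iter_sum h k {()} (fun _ => h⁻¹) (fun _ => iteratedDeriv k (fwdDiff h g)) (by
      intro i _
      exact h4.continuous_iteratedDeriv k (by exact_mod_cast le_top))
    simp only [Finset.sum_singleton] at h3
    rw [h3, ih _ h4]
    funext s
    rw [iterate_succ_apply, pow_succ, mul_inv]
    ring

lemma exists_antideriv (k : ℕ) (φ : ℝ → ℝ) (h : ContDiff ℝ (⊤ : ℕ∞) φ) :
    ∃ Φ : ℝ → ℝ, ContDiff ℝ (⊤ : ℕ∞) Φ ∧ iteratedDeriv k Φ = φ := by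
  induction k generalizing φ with
  | zero => exact ⟨φ, h, by simp⟩
  | succ k ih =>
    have h2 : deriv (fun x => ∫ t in (0:ℝ)..x, φ t) = φ := by
      funext x
      exact (Continuous.deriv_integral φ h.continuous 0 x)
    have h1 : ContDiff ℝ (⊤ : ℕ∞) (fun x => ∫ t in (0:ℝ)..x, φ t) := by
      rw [contDiff_infty_iff_deriv]
      refine ⟨fun x => ?_, by rwa [h2]⟩
      exact (intervalIntegral.integral_hasDerivAt_right (h.continuous.intervalIntegrable _ _)
        (h.continuous.stronglyMeasurableAtFilter _ _) h.continuous.continuousAt).differentiableAt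
    obtain ⟨Φ, hΦ, h3⟩ := ih _ h1
    refine ⟨Φ, hΦ, ?_⟩
    rw [iteratedDeriv_succ, h3, h2]

lemma taylor_l1 (l : ℕ) (u : ℝ → ℝ) (hu : ContDiff ℝ (⊤ : ℕ∞) u) :
    ∃ a : ℕ → ℝ, ∀ x ∈ Icc (0:ℝ) 1, |u x - ∑ i ∈ Finset.range (l + 1), a i * x ^ i| ≤
      ∫ t in (0:ℝ)..1, |iteratedDeriv (l + 1) u t| := by
  induction l generalizing u with
  | zero =>
    refine ⟨fun _ => u 0, fun x hx => ?_⟩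
    have e : u x - u 0 = ∫ t in (0:ℝ)..x, deriv u t := by
      rw [intervalIntegral.integral_deriv_eq_sub]
      · intro x _
        exact (hu.differentiable (by simp)).differentiableAt
      · apply Continuous.intervalIntegrable
        exact hu.continuous_deriv (by simp)
    have hc : Continuous (deriv u) := hu.continuous_deriv (by simp)
    simp only [zero_add, Finset.range_one, Finset.sum_singleton, pow_zero, mul_one,
      iteratedDeriv_one]
    rw [e]
    refine (intervalIntegral.abs_integral_le_integral_abs hx.1).trans ?_
    apply intervalIntegral.integral_mono_interval le_rfl hx.1 hx.2
    · exact Filter.Eventually.of_forall fun t => abs_nonneg _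
    · exact hc.abs.intervalIntegrable _ _
  | succ l ih =>
    have hu' : ContDiff ℝ (⊤ : ℕ∞) (deriv u) := (contDiff_infty_iff_deriv.1 hu).2
    obtain ⟨a, ha⟩ := ih (deriv u) hu'
    refine ⟨fun i => if i = 0 then u 0 else a (i - 1) / i, fun x hx => ?_⟩
    have e : u x - u 0 = ∫ t in (0:ℝ)..x, deriv u t := by
      rw [intervalIntegral.integral_deriv_eq_sub]
      · intro x _
        exact (hu.differentiable (by simp)).differentiableAt
      · apply Continuous.intervalIntegrable
        exact hu'.continuous
    have e2 : ∑ i ∈ Finset.range (l + 1), a i * (x ^ (i + 1) / (i + 1 : ℝ)) =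
        ∫ t in (0:ℝ)..x, ∑ i ∈ Finset.range (l + 1), a i * t ^ i := by
      rw [intervalIntegral.integral_finsetSum]
      · refine Finset.sum_congr rfl fun i hi => ?_
        rw [intervalIntegral.integral_const_mul, integral_pow]
        simp
      · intro i _
        apply Continuous.intervalIntegrable; fun_prop
    have e3 : u x - ∑ i ∈ Finset.range (l + 1 + 1),
        (if i = 0 then u 0 else a (i - 1) / (i : ℝ)) * x ^ i =
        ∫ t in (0:ℝ)..x, (deriv u t - ∑ i ∈ Finset.range (l + 1), a i * t ^ i) := by
      rw [intervalIntegral.integral_sub, ← e, ← e2, Finset.sum_range_succ']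
      · simp only [Nat.add_eq_zero_iff, one_ne_zero, and_false, if_false, if_true, pow_zero,
          mul_one, Nat.add_sub_cancel]
        have : ∀ i ∈ Finset.range (l+1), a i / ((i + 1 : ℕ) : ℝ) * x ^ (i + 1) =
          a i * (x ^ (i + 1) / (i + 1 : ℝ)) := by intro i _; push_cast; ring
        rw [Finset.sum_congr rfl this]; ring
      · exact hu'.continuous.intervalIntegrable _ _
      · apply Continuous.intervalIntegrable; fun_prop
    rw [e3]
    have h5 := intervalIntegral.norm_integral_le_of_norm_le_const (a := 0) (b := x)
      (f := fun t => deriv u t - ∑ i ∈ Finset.range (l + 1), a i * t ^ i)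
      (C := ∫ t in (0:ℝ)..1, |iteratedDeriv (l + 1) (deriv u) t|) (by
        intro t ht
        rw [uIoc_of_le hx.1] at ht
        exact ha t ⟨ht.1.le, ht.2.trans hx.2⟩)
    rw [Real.norm_eq_abs] at h5
    refine h5.trans ?_
    rw [← iteratedDeriv_succ', sub_zero, abs_of_nonneg hx.1]
    have h6 : 0 ≤ ∫ t in (0:ℝ)..1, |iteratedDeriv (l + 1 + 1) u t| :=
      intervalIntegral.integral_nonneg zero_le_one fun _ _ => abs_nonneg _
    nlinarith [hx.2]

end NBExt

namespace NBExt

lemma aff_deriv (k : ℕ) (Φ : ℝ → ℝ) (hΦ : ContDiff ℝ (⊤ : ℕ∞) Φ) (α β : ℝ) :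
    iteratedDeriv k (fun s => Φ (α * s + β)) = fun s => α ^ k * iteratedDeriv k Φ (α * s + β) := by
  have h1 : ContDiff ℝ k (fun z => Φ (z + β)) :=
    (hΦ.comp (contDiff_id.add contDiff_const)).of_le (by exact_mod_cast le_top)
  have := iteratedDeriv_comp_const_mul h1 α
  rw [this, iteratedDeriv_comp_add_const]

lemma av_iter_aff (k : ℕ) (Φ : ℝ → ℝ) (hΦ : ContDiff ℝ (⊤ : ℕ∞) Φ) (b β h z : ℝ) (hb : b ≠ 0)
    (hh : h ≠ 0) : (av h)^[k] (fun s => iteratedDeriv k Φ (b * s + β)) z =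
      ((b * h) ^ k)⁻¹ * dif k (b * h) Φ (b * z + β) := by
  have hg : ContDiff ℝ (⊤ : ℕ∞) (fun s => Φ (b * s + β)) :=
    hΦ.comp ((contDiff_const.mul contDiff_id).add contDiff_const)
  have hc : Continuous (iteratedDeriv k Φ) := hΦ.continuous_iteratedDeriv k (by exact_mod_cast le_top)
  have h1 := av_iter_deriv h hh k _ hg
  rw [aff_deriv k Φ hΦ] at h1
  have h2 := av_iter_sum h k {()} (fun _ => b ^ k) (fun _ s => iteratedDeriv k Φ (b * s + β)) (by
    intro _ _; fun_prop)
  simp only [Finset.sum_singleton] at h2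
  rw [h2] at h1
  have h3 := congrFun h1 z
  rw [← dif_eq_fwdDiff] at h3
  have h4 : dif k h (fun s => Φ (b * s + β)) z = dif k (b * h) Φ (b * z + β) := by
    unfold dif
    refine Finset.sum_congr rfl fun i _ => ?_
    simp only
    congr 2; ring
  rw [h4] at h3
  have hbk : b ^ k ≠ 0 := pow_ne_zero _ hb
  rw [mul_pow, mul_inv, mul_assoc, ← h3, inv_mul_cancel_left₀ hbk]

/-- smoothed function -/
def uu (k : ℕ) (h z : ℝ) (Φ : ℝ → ℝ) (x : ℝ) : ℝ :=
  ∑ i ∈ Finset.range k, ((-1 : ℝ) ^ i * (k.choose (i + 1) : ℝ)) *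
    (((((i + 1 : ℕ) : ℝ) / k * h) ^ k)⁻¹ * dif k (((i + 1 : ℕ) : ℝ) / k * h) Φ
      (((i + 1 : ℕ) : ℝ) / k * z + (1 - ((i + 1 : ℕ) : ℝ) / k) * x))

lemma av_iter_const (h : ℝ) (k : ℕ) (c : ℝ) : (av h)^[k] (fun _ => c) = fun _ => c := by
  induction k with
  | zero => rfl
  | succ k ih => rw [iterate_succ_apply', ih]; funext s; simp [av]

lemma sub_uu (k : ℕ) (hk : 0 < k) (h z : ℝ) (hh : h ≠ 0) (Φ : ℝ → ℝ)
    (hΦ : ContDiff ℝ (⊤ : ℕ∞) Φ) (x : ℝ) :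
    iteratedDeriv k Φ x - uu k h z Φ x =
      (av h)^[k] (fun s => (-1) ^ k * dif k ((s - x) / k) (iteratedDeriv k Φ) x) z := by
  have hc : Continuous (iteratedDeriv k Φ) := hΦ.continuous_iteratedDeriv k (by exact_mod_cast le_top)
  have hk' : (k : ℝ) ≠ 0 := by positivity
  have e1 : (fun s => (-1) ^ k * dif k ((s - x) / k) (iteratedDeriv k Φ) x) =
      fun s => ∑ i ∈ Finset.range (k + 1), ((-1 : ℝ) ^ i * (k.choose i : ℝ)) *
        (fun s => iteratedDeriv k Φ ((i : ℝ) / k * s + (1 - (i : ℝ) / k) * x)) s := by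
    funext s
    unfold dif
    rw [Finset.mul_sum]
    refine Finset.sum_congr rfl fun i hi => ?_
    have hi' : i ≤ k := Nat.lt_succ_iff.1 (Finset.mem_range.1 hi)
    have e2 : (-1 : ℝ) ^ k * (-1) ^ (k - i) = (-1) ^ i := by
      obtain ⟨m, rfl⟩ := Nat.exists_eq_add_of_le hi'
      rw [Nat.add_sub_cancel_left, pow_add, mul_assoc, ← mul_pow]; simp
    rw [← mul_assoc, ← mul_assoc, e2]
    simp only
    congr 2
    field_simp
    ring
  rw [e1, av_iter_sum]
  · simp only
    rw [Finset.sum_range_succ']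
    have e0 : (fun s : ℝ => iteratedDeriv k Φ (((0:ℕ) : ℝ) / k * s + (1 - ((0:ℕ) : ℝ) / k) * x)) =
      fun _ => iteratedDeriv k Φ x := by funext s; simp
    rw [e0, av_iter_const]
    unfold uu
    rw [sub_eq_neg_add, ← Finset.sum_neg_distrib]
    congr 1
    · refine Finset.sum_congr rfl fun i hi => ?_
      rw [av_iter_aff k Φ hΦ _ _ h z (by positivity) hh, pow_succ]
      ring
    · simp
  · intro i _; fun_prop

lemma dif_contDiff (k : ℕ) (ξ : ℝ) (φ : ℝ → ℝ) (hφ : ContDiff ℝ (⊤ : ℕ∞) φ) :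
    ContDiff ℝ (⊤ : ℕ∞) (dif k ξ φ) := by
  unfold dif
  apply ContDiff.sum
  intro i _
  exact contDiff_const.mul (hφ.comp (contDiff_id.add contDiff_const))

lemma uu_contDiff (k : ℕ) (h z : ℝ) (Φ : ℝ → ℝ) (hΦ : ContDiff ℝ (⊤ : ℕ∞) Φ) :
    ContDiff ℝ (⊤ : ℕ∞) (uu k h z Φ) := by
  unfold uu
  apply ContDiff.sum
  intro i _
  exact contDiff_const.mul (contDiff_const.mul ((dif_contDiff k _ Φ hΦ).comp
    (contDiff_const.add (contDiff_const.mul contDiff_id))))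

lemma dif_deriv (k n : ℕ) (ξ : ℝ) (φ : ℝ → ℝ) (hφ : ContDiff ℝ (⊤ : ℕ∞) φ) :
    iteratedDeriv n (dif k ξ φ) = dif k ξ (iteratedDeriv n φ) := by
  funext x
  unfold dif
  rw [iteratedDeriv_fun_sum]
  · refine Finset.sum_congr rfl fun i _ => ?_
    rw [iteratedDeriv_const_mul_field, iteratedDeriv_comp_add_const]
  · intro i _
    exact ((contDiff_const.mul (hφ.comp (contDiff_id.add contDiff_const))).of_le
      (by exact_mod_cast le_top)).contDiffAt

lemma uu_deriv (k : ℕ) (h z : ℝ) (Φ : ℝ → ℝ) (hΦ : ContDiff ℝ (⊤ : ℕ∞) Φ) (x : ℝ) :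
    iteratedDeriv k (uu k h z Φ) x =
    ∑ i ∈ Finset.range k, ((-1 : ℝ) ^ i * (k.choose (i + 1) : ℝ)) *
    (((((i + 1 : ℕ) : ℝ) / k * h) ^ k)⁻¹ * ((1 - ((i + 1 : ℕ) : ℝ) / k) ^ k *
     dif k (((i + 1 : ℕ) : ℝ) / k * h) (iteratedDeriv k Φ)
      (((i + 1 : ℕ) : ℝ) / k * z + (1 - ((i + 1 : ℕ) : ℝ) / k) * x))) := by
  unfold uu
  rw [iteratedDeriv_fun_sum]
  · refine Finset.sum_congr rfl fun i _ => ?_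
    rw [iteratedDeriv_const_mul_field, iteratedDeriv_const_mul_field]
    congr 2
    simp_rw [add_comm _ ((1 - ((i + 1 : ℕ) : ℝ) / k) * _)]
    rw [aff_deriv k _ (dif_contDiff k _ Φ hΦ), dif_deriv k k _ _ hΦ]
  · intro i _
    exact ((contDiff_const.mul (contDiff_const.mul ((dif_contDiff k _ Φ hΦ).comp
    (contDiff_const.add (contDiff_const.mul contDiff_id))))).of_le
      (by exact_mod_cast le_top)).contDiffAt

/-- domain of the difference in the unit interval -/
def dom (k : ℕ) (ξ : ℝ) : Set ℝ := {x | x ∈ Ioo (0:ℝ) 1 ∧ x + k * ξ ∈ Ioo (0:ℝ) 1}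

lemma dom_meas (k : ℕ) (ξ : ℝ) : MeasurableSet (dom k ξ) := by
  apply MeasurableSet.inter measurableSet_Ioo
  exact measurableSet_Ioo.preimage (by fun_prop)

def Wf (k : ℕ) (φ : ℝ → ℝ) (ξ : ℝ) : ℝ≥0∞ := ∫⁻ x in dom k ξ, ‖dif k ξ φ x‖ₑ

lemma dif_cont2 (k : ℕ) (φ : ℝ → ℝ) (hφ : Continuous φ) :
    Continuous fun q : ℝ × ℝ => dif k q.1 φ q.2 := by
  unfold dif; fun_prop

lemma dom_meas2 (k : ℕ) : MeasurableSet {q : ℝ × ℝ | q.2 ∈ dom k q.1} := by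
  apply MeasurableSet.inter
  · exact measurableSet_Ioo.preimage (by fun_prop)
  · exact measurableSet_Ioo.preimage (f := fun q : ℝ × ℝ => q.2 + k * q.1) (by fun_prop)

lemma Wf_meas (k : ℕ) (φ : ℝ → ℝ) (hφ : Continuous φ) : Measurable (Wf k φ) := by
  have : Wf k φ = fun ξ => ∫⁻ x, {q : ℝ × ℝ | q.2 ∈ dom k q.1}.indicator
      (fun q => ‖dif k q.1 φ q.2‖ₑ) (ξ, x) := by
    funext ξ
    unfold Wf
    rw [← lintegral_indicator (dom_meas k ξ)]
    rfl
  rw [this]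
  apply Measurable.lintegral_prod_right'
  exact ((dif_cont2 k φ hφ).measurable.enorm).indicator (dom_meas2 k)

end NBExt

namespace NBExt

lemma avg1 (k : ℕ) (hk : 0 < k) (φ : ℝ → ℝ) (hφ : Continuous φ) :
    ∫⁻ x in Ioo (0:ℝ) 1, ∫⁻ y in Ioo (0:ℝ) 1, ‖dif k ((y - x) / k) φ x‖ₑ ≤
      (k : ℝ≥0∞) * ∫⁻ ξ in Icc (-1:ℝ) 1, Wf k φ ξ := by
  have hk' : (0:ℝ) < k := by positivity
  have hk1 : (1:ℝ) ≤ k := by exact_mod_cast hk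
  set G : ℝ × ℝ → ℝ≥0∞ := {q : ℝ × ℝ | q.2 ∈ dom k q.1}.indicator
      (fun q => ‖dif k q.1 φ q.2‖ₑ) with hG
  have hGm : Measurable G := ((dif_cont2 k φ hφ).measurable.enorm).indicator (dom_meas2 k)
  have h1 : ∀ x ∈ Ioo (0:ℝ) 1, ∫⁻ y in Ioo (0:ℝ) 1, ‖dif k ((y - x) / k) φ x‖ₑ ≤
      (k : ℝ≥0∞) * ∫⁻ ξ in Icc (-1:ℝ) 1, G (ξ, x) := by
    intro x hx
    have h2 := lint_chg (fun ξ => G (ξ, x)) (1 / k) (- x / k) (by positivity) (Ioo 0 1) (Icc (-1) 1)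
      measurableSet_Ioo measurableSet_Icc (by
        intro y hy
        have : 1 / (k:ℝ) * y + -x / k = (y - x) / k := by ring
        rw [this]
        constructor
        · rw [le_div_iff₀ hk']; linarith [hy.1, hx.2]
        · rw [div_le_iff₀ hk']; linarith [hy.2, hx.1])
    have h3 : ENNReal.ofReal |(1 / (k:ℝ))⁻¹| = (k : ℝ≥0∞) := by
      rw [one_div, inv_inv, abs_of_pos hk', ENNReal.ofReal_natCast]
    rw [h3] at h2
    refine le_trans (le_of_eq ?_) h2
    apply setLIntegral_congr_fun measurableSet_Ioo
    intro y hy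
    have e : 1 / (k:ℝ) * y + -x / k = (y - x) / k := by ring
    simp only [e]
    have e2 : x + k * ((y - x) / k) = y := by field_simp; ring
    rw [hG, indicator_of_mem]
    exact ⟨hx, by simpa only [e2] using hy⟩
  calc _ ≤ ∫⁻ x in Ioo (0:ℝ) 1, (k : ℝ≥0∞) * ∫⁻ ξ in Icc (-1:ℝ) 1, G (ξ, x) :=
        setLIntegral_mono' measurableSet_Ioo h1
    _ = (k : ℝ≥0∞) * ∫⁻ x in Ioo (0:ℝ) 1, ∫⁻ ξ in Icc (-1:ℝ) 1, G (ξ, x) := by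
        rw [lintegral_const_mul' _ _ (by simp)]
    _ = (k : ℝ≥0∞) * ∫⁻ ξ in Icc (-1:ℝ) 1, ∫⁻ x in Ioo (0:ℝ) 1, G (ξ, x) := by
        rw [lintegral_lintegral_swap]
        exact (hGm.comp measurable_swap).aemeasurable
    _ ≤ _ := by
        gcongr with ξ
        unfold Wf
        rw [← lintegral_indicator (dom_meas k ξ)]
        exact setLIntegral_le_lintegral _ _

lemma step_b (k : ℕ) (hk : 0 < k) (h : ℝ) (hh : 0 < h) (hh2 : k * h ≤ 1 / 2) (Φ : ℝ → ℝ)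
    (hΦ : ContDiff ℝ (⊤ : ℕ∞) Φ) :
    ∫⁻ z in Ioo (0:ℝ) (1 / 2), ∫⁻ x in Ioo (0:ℝ) 1, ‖iteratedDeriv k Φ x - uu k h z Φ x‖ₑ ≤
      (k : ℝ≥0∞) * ∫⁻ ξ in Icc (-1:ℝ) 1, Wf k (iteratedDeriv k Φ) ξ := by
  have hc : Continuous (iteratedDeriv k Φ) := hΦ.continuous_iteratedDeriv k (by exact_mod_cast le_top)
  have hc0 : Continuous Φ := hΦ.continuous
  refine le_trans ?_ (avg1 k hk _ hc)
  rw [lintegral_lintegral_swap]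
  · apply lintegral_mono
    intro x
    simp only
    simp_rw [sub_uu k hk h _ hh.ne' Φ hΦ x]
    refine (av_iter_bound h _ hh.le k _ ?_).trans ?_
    · have := dif_cont2 k _ hc
      have h2 : Continuous fun s : ℝ => dif k ((s - x) / k) (iteratedDeriv k Φ) x :=
        this.comp (f := fun s : ℝ => ((s - x) / k, x)) (by fun_prop)
      fun_prop
    · refine (lintegral_mono_set (Ioo_subset_Ioo le_rfl (by linarith : 1 / 2 + k * h ≤ 1))).trans ?_
      apply lintegral_mono
      intro s
      simp only [enorm_mul, enorm_pow, enorm_neg, enorm_one, one_pow, one_mul]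
      exact le_rfl
  · apply Measurable.aemeasurable
    apply Measurable.enorm
    have : Continuous fun q : ℝ × ℝ => iteratedDeriv k Φ q.2 - uu k h q.1 Φ q.2 := by
      unfold uu dif
      fun_prop
    exact this.measurable

lemma step_a (l : ℕ) (h z : ℝ) (hh : 1 / (4 * ((l + 1 : ℕ) : ℝ)) ≤ h)
    (hh2 : ((l + 1 : ℕ) : ℝ) * h ≤ 1 / 2) (hz : z ∈ Ioo (0:ℝ) (1 / 2)) (Φ : ℝ → ℝ)
    (hΦ : ContDiff ℝ (⊤ : ℕ∞) Φ) :
    ∫⁻ x in Ioo (0:ℝ) 1, ‖iteratedDeriv (l + 1) (uu (l + 1) h z Φ) x‖ₑ ≤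
      ENNReal.ofReal (2 ^ (l + 1) * (4 * ((l + 1 : ℕ) : ℝ) ^ 2) ^ (l + 1) * ((l + 1 : ℕ) : ℝ)) *
      ∑ i ∈ Finset.range l, Wf (l + 1) (iteratedDeriv (l + 1) Φ)
        (((i + 1 : ℕ) : ℝ) / ((l + 1 : ℕ) : ℝ) * h) := by
  have hk0 : (0:ℝ) < ((l + 1 : ℕ) : ℝ) := by positivity
  have hc : Continuous (iteratedDeriv (l + 1) Φ) :=
    hΦ.continuous_iteratedDeriv (l + 1) (by exact_mod_cast le_top)
  have hh0 : 0 < h := lt_of_lt_of_le (by positivity) hh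
  generalize hφ : iteratedDeriv (l + 1) Φ = φ at hc
  have hd : ∀ x, ‖iteratedDeriv (l + 1) (uu (l + 1) h z Φ) x‖ₑ ≤ ∑ i ∈ Finset.range l,
      ENNReal.ofReal (2 ^ (l + 1) * (4 * ((l + 1 : ℕ) : ℝ) ^ 2) ^ (l + 1)) *
      ‖dif (l + 1) (((i + 1 : ℕ) : ℝ) / ((l + 1 : ℕ) : ℝ) * h) φ
        ((1 - ((i + 1 : ℕ) : ℝ) / ((l + 1 : ℕ) : ℝ)) * x +
          ((i + 1 : ℕ) : ℝ) / ((l + 1 : ℕ) : ℝ) * z)‖ₑ := by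
    intro x
    rw [uu_deriv _ _ _ _ hΦ, hφ, Finset.sum_range_succ, div_self hk0.ne', sub_self,
      zero_pow (Nat.succ_ne_zero l)]
    simp only [zero_mul, mul_zero, add_zero]
    refine (enorm_sum_le _ _).trans (Finset.sum_le_sum fun i hi => ?_)
    rw [← mul_assoc, ← mul_assoc, enorm_mul, add_comm ((1 - ((i + 1 : ℕ) : ℝ) / ((l + 1 : ℕ) : ℝ)) * x)]
    gcongr
    rw [Real.enorm_eq_ofReal_abs]
    apply ENNReal.ofReal_le_ofReal
    have hi' : i < l := Finset.mem_range.1 hi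
    set b : ℝ := ((i + 1 : ℕ) : ℝ) / ((l + 1 : ℕ) : ℝ) with hb
    have hb1 : b ≤ 1 := by
      rw [hb, div_le_one hk0]; exact_mod_cast (by omega : i + 1 ≤ l + 1)
    have hb0 : 1 / ((l + 1 : ℕ) : ℝ) ≤ b := by
      rw [hb]; gcongr; exact_mod_cast (by omega : 1 ≤ i + 1)
    have hbp : 0 < b := lt_of_lt_of_le (by positivity) hb0
    rw [abs_mul, abs_mul, abs_mul, abs_pow, abs_neg, abs_one, one_pow, one_mul, Nat.abs_cast,
      abs_inv, abs_pow, abs_pow, abs_of_nonneg (by linarith : 0 ≤ 1 - b),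
      abs_of_pos (mul_pos hbp hh0)]
    have c1 : (((l + 1).choose (i + 1) : ℕ) : ℝ) ≤ 2 ^ (l + 1) := by
      exact_mod_cast Nat.choose_le_two_pow _ _
    have c2 : (1 - b) ^ (l + 1) ≤ 1 := pow_le_one₀ (by linarith) (by linarith)
    have c3 : ((b * h) ^ (l + 1))⁻¹ ≤ (4 * ((l + 1 : ℕ) : ℝ) ^ 2) ^ (l + 1) := by
      rw [← inv_pow]
      gcongr
      rw [inv_le_comm₀ (mul_pos hbp hh0) (by positivity)]
      calc (4 * ((l + 1 : ℕ) : ℝ) ^ 2)⁻¹ = 1 / ((l + 1 : ℕ) : ℝ) * (1 / (4 * ((l + 1 : ℕ) : ℝ))) := by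
            field_simp
        _ ≤ b * h := by gcongr
    calc _ ≤ (2:ℝ) ^ (l + 1) * (4 * ((l + 1 : ℕ) : ℝ) ^ 2) ^ (l + 1) * 1 := by
          gcongr
      _ = _ := by ring
  refine (lintegral_mono hd).trans ?_
  rw [lintegral_finsetSum', Finset.mul_sum]
  · refine Finset.sum_le_sum fun i hi => ?_
    rw [lintegral_const_mul' _ _ ENNReal.ofReal_ne_top,
      ENNReal.ofReal_mul (p := 2 ^ (l + 1) * (4 * ((l + 1 : ℕ) : ℝ) ^ 2) ^ (l + 1)) (by positivity), mul_assoc]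
    gcongr
    have hi' : i < l := Finset.mem_range.1 hi
    set b : ℝ := ((i + 1 : ℕ) : ℝ) / ((l + 1 : ℕ) : ℝ) with hb
    have hb1 : 1 / ((l + 1 : ℕ) : ℝ) ≤ 1 - b := by
      rw [hb, le_sub_iff_add_le, ← add_div, div_le_one hk0]
      exact_mod_cast (by omega : 1 + (i + 1) ≤ l + 1)
    have hb1' : 0 < 1 - b := lt_of_lt_of_le (by positivity) hb1
    have hb0 : 0 < b := by positivity
    have h2 := lint_chg (fun w => ‖dif (l + 1) (b * h) φ w‖ₑ) (1 - b) (b * z) hb1'.ne' (Ioo 0 1)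
      (dom (l + 1) (b * h)) measurableSet_Ioo (dom_meas _ _) (by
        intro x hx
        have q1 : 0 < (1 - b) * x := mul_pos hb1' hx.1
        have q2 : (1 - b) * x < 1 - b := by nlinarith [hx.2]
        have q3 : 0 < b * z := mul_pos hb0 hz.1
        have q4 : b * z < b * (1 / 2) := by nlinarith [hz.2]
        have q5 : ((l + 1 : ℕ) : ℝ) * (b * h) ≤ b * (1 / 2) := by nlinarith
        have q6 : 0 < ((l + 1 : ℕ) : ℝ) * (b * h) := by positivity
        exact ⟨⟨by linarith, by linarith⟩, ⟨by linarith, by linarith⟩⟩)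
    refine h2.trans ?_
    unfold Wf
    gcongr
    rw [abs_of_pos (inv_pos.2 hb1'), inv_le_comm₀ hb1' hk0, ← one_div]
    exact hb1
  · intro i _
    apply Measurable.aemeasurable
    apply Measurable.const_mul
    apply Measurable.enorm
    apply Continuous.measurable
    unfold dif
    fun_prop

lemma whitney1 (l : ℕ) : ∃ C : ℝ≥0, ∀ φ : ℝ → ℝ, ContDiff ℝ (⊤ : ℕ∞) φ → ∀ N : ℝ≥0∞,
    (∀ a : ℕ → ℝ, N ≤ ∫⁻ x in Ioo (0:ℝ) 1, ‖φ x - ∑ i ∈ Finset.range (l + 1), a i * x ^ i‖ₑ) →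
    N ≤ C * ∫⁻ ξ in Icc (-1:ℝ) 1, Wf (l + 1) φ ξ := by
  have hk0 : (0:ℝ) < ((l + 1 : ℕ) : ℝ) := by positivity
  set M : ℝ := 2 ^ (l + 1) * (4 * ((l + 1 : ℕ) : ℝ) ^ 2) ^ (l + 1) * ((l + 1 : ℕ) : ℝ) with hM
  set k : ℝ := ((l + 1 : ℕ) : ℝ) with hk
  refine ⟨Real.toNNReal (2 * k + 4 * k * (M * (l * k))), fun φ hφ N hN => ?_⟩
  obtain ⟨Φ, hΦ, hΦφ⟩ := exists_antideriv (l + 1) φ hφ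
  have hc := hφ.continuous
  set R : ℝ≥0∞ := ∫⁻ ξ in Icc (-1:ℝ) 1, Wf (l + 1) φ ξ with hR
  have key : ∀ h ∈ Ioo (1 / (4 * k)) (1 / (2 * k)), ∀ z ∈ Ioo (0:ℝ) (1 / 2), N ≤
      (∫⁻ x in Ioo (0:ℝ) 1, ‖φ x - uu (l + 1) h z Φ x‖ₑ) + ENNReal.ofReal M *
        ∑ i ∈ Finset.range l, Wf (l + 1) φ (((i + 1 : ℕ) : ℝ) / k * h) := by
    intro h hh z hz
    have hhk : k * h ≤ 1 / 2 := by
      have := hh.2.le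
      rw [le_div_iff₀ (by positivity)] at this
      linarith
    have ha := step_a l h z hh.1.le hhk hz Φ hΦ
    rw [hΦφ, ← hk, ← hM] at ha
    obtain ⟨a, hta⟩ := taylor_l1 l _ (uu_contDiff (l + 1) h z Φ hΦ)
    have hcu : Continuous (uu (l + 1) h z Φ) := (uu_contDiff (l + 1) h z Φ hΦ).continuous
    have hcd : Continuous (iteratedDeriv (l + 1) (uu (l + 1) h z Φ)) :=
      (uu_contDiff (l + 1) h z Φ hΦ).continuous_iteratedDeriv _ (by exact_mod_cast le_top)
    have h1 : ∀ x ∈ Ioo (0:ℝ) 1, ‖uu (l + 1) h z Φ x - ∑ i ∈ Finset.range (l + 1), a i * x ^ i‖ₑ ≤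
        ∫⁻ x in Ioo (0:ℝ) 1, ‖iteratedDeriv (l + 1) (uu (l + 1) h z Φ) x‖ₑ := by
      intro x hx
      have h2 := hta x (Ioo_subset_Icc_self hx)
      rw [Real.enorm_eq_ofReal_abs]
      refine (ENNReal.ofReal_le_ofReal h2).trans (le_of_eq ?_)
      rw [intervalIntegral.integral_of_le zero_le_one, integral_Ioc_eq_integral_Ioo]
      simp_rw [← Real.norm_eq_abs]
      apply ofReal_integral_norm_eq_lintegral_enorm
      exact (hcd.integrableOn_Icc (a := 0) (b := 1)).mono_set Ioo_subset_Icc_self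
    calc N ≤ _ := hN a
      _ ≤ ∫⁻ x in Ioo (0:ℝ) 1, (‖φ x - uu (l + 1) h z Φ x‖ₑ +
          ∫⁻ x in Ioo (0:ℝ) 1, ‖iteratedDeriv (l + 1) (uu (l + 1) h z Φ) x‖ₑ) := by
          apply setLIntegral_mono' measurableSet_Ioo
          intro x hx
          refine le_trans ?_ (add_le_add le_rfl (h1 x hx))
          refine le_trans (le_of_eq ?_) (enorm_add_le _ _)
          congr 1; ring
      _ = (∫⁻ x in Ioo (0:ℝ) 1, ‖φ x - uu (l + 1) h z Φ x‖ₑ) +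
          ∫⁻ x in Ioo (0:ℝ) 1, ‖iteratedDeriv (l + 1) (uu (l + 1) h z Φ) x‖ₑ := by
          rw [lintegral_add_right _ measurable_const]
          simp
      _ ≤ _ := by gcongr
  have key2 : ∀ h ∈ Ioo (1 / (4 * k)) (1 / (2 * k)), N ≤ ENNReal.ofReal (2 * k) * R +
      ENNReal.ofReal M * ∑ i ∈ Finset.range l, Wf (l + 1) φ (((i + 1 : ℕ) : ℝ) / k * h) := by
    intro h hh
    have hhk : k * h ≤ 1 / 2 := by
      have := hh.2.le
      rw [le_div_iff₀ (by positivity)] at this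
      linarith
    have hh0 : 0 < h := lt_trans (by positivity) hh.1
    have hb := step_b (l + 1) (Nat.succ_pos l) h hh0 hhk Φ hΦ
    rw [hΦφ] at hb
    have h1 : ∫⁻ z in Ioo (0:ℝ) (1 / 2), N ≤ ∫⁻ z in Ioo (0:ℝ) (1 / 2),
      ((∫⁻ x in Ioo (0:ℝ) 1, ‖φ x - uu (l + 1) h z Φ x‖ₑ) + ENNReal.ofReal M *
        ∑ i ∈ Finset.range l, Wf (l + 1) φ (((i + 1 : ℕ) : ℝ) / k * h)) :=
      setLIntegral_mono' measurableSet_Ioo (key h hh)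
    rw [lintegral_add_right _ measurable_const] at h1
    simp only [lintegral_const, MeasurableSet.univ, Measure.restrict_apply, univ_inter,
      Real.volume_Ioo, sub_zero] at h1
    have h2 : N * ENNReal.ofReal (1 / 2) ≤ (((l + 1 : ℕ) : ℝ≥0∞) * R + ENNReal.ofReal (1 / 2) *
        (ENNReal.ofReal M * ∑ i ∈ Finset.range l, Wf (l + 1) φ (((i + 1 : ℕ) : ℝ) / k * h))) := by
      refine h1.trans ?_
      rw [mul_comm (ENNReal.ofReal (1 / 2))]
      gcongr
    have h3 : N = ENNReal.ofReal 2 * (N * ENNReal.ofReal (1 / 2)) := by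
      rw [mul_comm N, ← mul_assoc, ← ENNReal.ofReal_mul (by norm_num)]; norm_num
    rw [h3]
    refine (mul_le_mul_right h2 _).trans (le_of_eq ?_)
    have e2 : ENNReal.ofReal 2 * ENNReal.ofReal (1 / 2) = 1 := by
      rw [← ENNReal.ofReal_mul (by norm_num)]; norm_num
    have e3 : ENNReal.ofReal (2 * k) = ENNReal.ofReal 2 * ((l + 1 : ℕ) : ℝ≥0∞) := by
      rw [ENNReal.ofReal_mul (by norm_num), hk, ENNReal.ofReal_natCast]
    rw [mul_add, ← mul_assoc, ← mul_assoc (ENNReal.ofReal 2) (ENNReal.ofReal (1 / 2)), e2, one_mul, e3]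
  have h4 : ∀ i ∈ Finset.range l, ∫⁻ h in Ioo (1 / (4 * k)) (1 / (2 * k)),
      Wf (l + 1) φ (((i + 1 : ℕ) : ℝ) / k * h) ≤ ENNReal.ofReal k * R := by
    intro i hi
    have hi' : i < l := Finset.mem_range.1 hi
    have hi1 : (1:ℝ) ≤ ((i + 1 : ℕ) : ℝ) := by exact_mod_cast (by omega : 1 ≤ i + 1)
    have hik : ((i + 1 : ℕ) : ℝ) ≤ k := by rw [hk]; exact_mod_cast (by omega : i + 1 ≤ l + 1)
    have hk1 : 1 ≤ k := hi1.trans hik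
    have h5 := lint_chg (Wf (l + 1) φ) (((i + 1 : ℕ) : ℝ) / k) 0 (by positivity)
      (Ioo (1 / (4 * k)) (1 / (2 * k))) (Icc (-1) 1) measurableSet_Ioo measurableSet_Icc (by
        intro h hh
        have hh0 : 0 < h := lt_trans (by positivity) hh.1
        have hb1 : ((i + 1 : ℕ) : ℝ) / k ≤ 1 := by rw [div_le_one hk0]; exact hik
        have hb0 : 0 < ((i + 1 : ℕ) : ℝ) / k := by positivity
        have hh1 : h ≤ 1 := hh.2.le.trans (by rw [div_le_one (by positivity)]; linarith)
        have : 0 < ((i + 1 : ℕ) : ℝ) / k * h := by positivity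
        have : ((i + 1 : ℕ) : ℝ) / k * h ≤ 1 := by nlinarith
        constructor <;> linarith)
    simp only [add_zero] at h5
    refine h5.trans ?_
    gcongr
    rw [abs_of_pos (by positivity), inv_div, div_le_iff₀ (by positivity)]
    nlinarith
  have h6 : ∫⁻ h in Ioo (1 / (4 * k)) (1 / (2 * k)), N ≤
      ∫⁻ h in Ioo (1 / (4 * k)) (1 / (2 * k)), (ENNReal.ofReal (2 * k) * R +
      ENNReal.ofReal M * ∑ i ∈ Finset.range l, Wf (l + 1) φ (((i + 1 : ℕ) : ℝ) / k * h)) :=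
    setLIntegral_mono' measurableSet_Ioo key2
  rw [lintegral_add_left measurable_const, lintegral_const_mul' (ENNReal.ofReal M) _ ENNReal.ofReal_ne_top,
    lintegral_finsetSum] at h6
  · simp only [lintegral_const, MeasurableSet.univ, Measure.restrict_apply, univ_inter,
      Real.volume_Ioo] at h6
    have e : 1 / (2 * k) - 1 / (4 * k) = 1 / (4 * k) := by field_simp; norm_num
    rw [e] at h6
    have h7 : N * ENNReal.ofReal (1 / (4 * k)) ≤ ENNReal.ofReal (2 * k) * R * ENNReal.ofReal (1 / (4 * k)) +
        ENNReal.ofReal M * (l * (ENNReal.ofReal k * R)) := by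
      refine h6.trans ?_
      gcongr
      refine (Finset.sum_le_sum h4).trans ?_
      simp
    have h8 : ENNReal.ofReal (1 / (4 * k)) * ENNReal.ofReal (4 * k) = 1 := by
      rw [← ENNReal.ofReal_mul (by positivity), one_div, inv_mul_cancel₀ (by positivity)]; simp
    have h9 := mul_le_mul_left h7 (ENNReal.ofReal (4 * k))
    rw [mul_assoc, h8, mul_one, add_mul, mul_assoc _ (ENNReal.ofReal (1 / (4 * k))), h8, mul_one] at h9
    refine h9.trans (le_of_eq ?_)
    have hM0 : 0 ≤ M := by positivity
    change _ = ENNReal.ofReal _ * R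
    have e5 : ENNReal.ofReal (l : ℝ) = (l : ℝ≥0∞) := ENNReal.ofReal_natCast l
    rw [ENNReal.ofReal_add (by positivity) (by positivity), ENNReal.ofReal_mul (p := 4 * k) (by positivity),
      ENNReal.ofReal_mul hM0, ENNReal.ofReal_mul (p := (l:ℝ)) (by positivity), e5]
    ring
  · intro i _
    exact (Wf_meas (l + 1) φ hc).comp (by fun_prop)

end NBExt

namespace NBExt

lemma intOn_cont (f : ℝ → ℝ) (hf : Continuous f) : IntegrableOn f (Ioo (0:ℝ) 1) :=
  (hf.integrableOn_Icc (a := 0) (b := 1)).mono_set Ioo_subset_Icc_self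

lemma poly_zero_of (n : ℕ) (v : Fin n → ℝ)
    (h : ∫ y in Ioo (0:ℝ) 1, (∑ i, v i * y ^ (i : ℕ)) ^ 2 = 0) : v = 0 := by
  have hc : Continuous fun y : ℝ => (∑ i, v i * y ^ (i : ℕ)) ^ 2 := by fun_prop
  rw [integral_eq_zero_iff_of_nonneg (fun y => by positivity) (intOn_cont _ hc)] at h
  have h2 := Measure.eqOn_open_of_ae_eq h isOpen_Ioo hc.continuousOn continuousOn_const
  set q : Polynomial ℝ := ∑ i : Fin n, Polynomial.C (v i) * Polynomial.X ^ (i : ℕ) with hq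
  have h3 : q = 0 := by
    apply Polynomial.eq_zero_of_infinite_isRoot
    apply (Ioo_infinite (zero_lt_one (α := ℝ))).mono
    intro y hy
    have := h2 hy
    simp only [Pi.zero_apply, pow_eq_zero_iff, ne_eq, OfNat.ofNat_ne_zero, not_false_eq_true] at this
    simp only [mem_ofPred_eq, Polynomial.IsRoot.def, hq, Polynomial.eval_finsetSum]
    simpa using this
  funext i
  have h4 : q.coeff i = v i := by
    rw [hq, Polynomial.finsetSum_coeff]
    simp only [Polynomial.coeff_C_mul_X_pow]
    rw [Finset.sum_eq_single i]
    · simp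
    · intro b _ hb
      rw [if_neg]
      exact fun h => hb (Fin.ext h.symm)
    · simp
  rw [← h4, h3]; simp

lemma exists_kernel (l : ℕ) : ∃ A : Fin (l + 1) → Fin (l + 1) → ℝ, (∀ i j, A i j = A j i) ∧
    ∀ (m : ℕ), m ≤ l → ∀ x : ℝ,
      ∫ y in Ioo (0:ℝ) 1, (∑ i, ∑ j, A i j * x ^ (i : ℕ) * y ^ (j : ℕ)) * y ^ m = x ^ m := by
  set G : Matrix (Fin (l + 1)) (Fin (l + 1)) ℝ :=
    Matrix.of fun i j => ∫ y in Ioo (0:ℝ) 1, y ^ (i : ℕ) * y ^ (j : ℕ) with hG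
  have hGT : G.transpose = G := by
    ext i j
    simp only [hG, Matrix.transpose_apply, Matrix.of_apply]
    congr 1; funext y; ring
  have hdet : IsUnit G.det := by
    rw [isUnit_iff_ne_zero]
    intro h0
    obtain ⟨v, hv, hGv⟩ := Matrix.exists_mulVec_eq_zero_iff.2 h0
    apply hv
    apply poly_zero_of
    have h1 : ∀ y : ℝ, (∑ i, v i * y ^ (i : ℕ)) ^ 2 =
        ∑ i, ∑ j, v i * (v j * (y ^ (i : ℕ) * y ^ (j : ℕ))) := by
      intro y
      rw [sq, Finset.sum_mul_sum]
      refine Finset.sum_congr rfl fun i _ => Finset.sum_congr rfl fun j _ => ?_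
      ring
    simp_rw [h1]
    rw [integral_finsetSum _ (fun i _ => intOn_cont _ (by fun_prop))]
    apply Finset.sum_eq_zero
    intro i _
    rw [integral_finsetSum _ (fun i _ => intOn_cont _ (by fun_prop))]
    simp_rw [integral_const_mul]
    rw [← Finset.mul_sum]
    have := congrFun hGv i
    simp only [Matrix.mulVec, dotProduct, hG, Matrix.of_apply, Pi.zero_apply] at this
    refine mul_eq_zero_of_right _ (Eq.trans ?_ this)
    refine Finset.sum_congr rfl fun j _ => mul_comm _ _
  refine ⟨fun i j => G⁻¹ i j, fun i j => ?_, fun m hm x => ?_⟩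
  · have := Matrix.transpose_nonsing_inv G
    rw [hGT] at this
    exact (congrFun (congrFun this j) i)
  · have h1 : ∀ y : ℝ, (∑ i, ∑ j, G⁻¹ i j * x ^ (i : ℕ) * y ^ (j : ℕ)) * y ^ m =
        ∑ i : Fin (l + 1), ∑ j : Fin (l + 1), x ^ (i : ℕ) * (G⁻¹ i j * (y ^ (j : ℕ) * y ^ m)) := by
      intro y
      rw [Finset.sum_mul]
      refine Finset.sum_congr rfl fun i _ => ?_
      rw [Finset.sum_mul]
      refine Finset.sum_congr rfl fun j _ => ?_
      ring
    simp_rw [h1]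
    rw [integral_finsetSum _ (fun i _ => intOn_cont _ (by fun_prop))]
    have h2 : ∀ i : Fin (l + 1), ∫ y in Ioo (0:ℝ) 1, ∑ j : Fin (l + 1),
        x ^ (i : ℕ) * (G⁻¹ i j * (y ^ (j : ℕ) * y ^ m)) =
        x ^ (i : ℕ) * (G⁻¹ * G) i ⟨m, by omega⟩ := by
      intro i
      rw [integral_finsetSum _ (fun i _ => intOn_cont _ (by fun_prop))]
      simp_rw [integral_const_mul]
      rw [← Finset.mul_sum, Matrix.mul_apply]
      simp [hG]
    simp_rw [h2, Matrix.nonsing_inv_mul G hdet, Matrix.one_apply]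
    simp

def kerA (l : ℕ) : Fin (l + 1) → Fin (l + 1) → ℝ := (exists_kernel l).choose

def ker1 (l : ℕ) (x y : ℝ) : ℝ := ∑ i, ∑ j, kerA l i j * x ^ (i : ℕ) * y ^ (j : ℕ)

lemma ker1_symm (l : ℕ) (x y : ℝ) : ker1 l x y = ker1 l y x := by
  unfold ker1
  rw [Finset.sum_comm]
  refine Finset.sum_congr rfl fun i _ => Finset.sum_congr rfl fun j _ => ?_
  rw [kerA, (exists_kernel l).choose_spec.1 j i]; ring

lemma ker1_repro (l m : ℕ) (hm : m ≤ l) (x : ℝ) :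
    ∫ y in Ioo (0:ℝ) 1, ker1 l x y * y ^ m = x ^ m :=
  (exists_kernel l).choose_spec.2 m hm x

lemma ker1_cont (l : ℕ) : Continuous fun q : ℝ × ℝ => ker1 l q.1 q.2 := by
  unfold ker1; fun_prop

lemma ker1_bound (l : ℕ) : ∃ C : ℝ≥0, ∀ x ∈ Icc (0:ℝ) 1, ∀ y ∈ Icc (0:ℝ) 1,
    ‖ker1 l x y‖₊ ≤ C := by
  refine ⟨∑ i, ∑ j, ‖kerA l i j‖₊, fun x hx y hy => ?_⟩
  unfold ker1
  refine (nnnorm_sum_le _ _).trans (Finset.sum_le_sum fun i _ => ?_)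
  refine (nnnorm_sum_le _ _).trans (Finset.sum_le_sum fun j _ => ?_)
  rw [nnnorm_mul, nnnorm_mul, mul_assoc]
  have h1 : ∀ x ∈ Icc (0:ℝ) 1, ∀ n : ℕ, ‖x ^ n‖₊ ≤ 1 := by
    intro x hx n
    rw [← NNReal.coe_le_coe, coe_nnnorm, Real.norm_of_nonneg (pow_nonneg hx.1 n)]
    exact pow_le_one₀ hx.1 hx.2
  calc _ ≤ ‖kerA l i j‖₊ * (1 * 1) := by
        gcongr
        · exact h1 x hx i
        · exact h1 y hy j
    _ = _ := by ring

def kC (l : ℕ) : ℝ≥0 := (ker1_bound l).choose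

lemma kC_spec (l : ℕ) (x y : ℝ) (hx : x ∈ Icc (0:ℝ) 1) (hy : y ∈ Icc (0:ℝ) 1) :
    ‖ker1 l x y‖ₑ ≤ kC l := by
  have := (ker1_bound l).choose_spec x hx y hy
  rw [enorm_eq_nnnorm]
  exact_mod_cast this

/-- one dimensional projection on the unit interval -/
def pi1 (l : ℕ) (φ : ℝ → ℝ) (x : ℝ) : ℝ := ∫ s in Ioo (0:ℝ) 1, ker1 l x s * φ s

lemma ker1_cont_right (l : ℕ) (x : ℝ) : Continuous fun y : ℝ => ker1 l x y :=
  (ker1_cont l).comp (by fun_prop : Continuous fun y : ℝ => (x, y))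

lemma pi1_bound (l : ℕ) (φ : ℝ → ℝ) (x : ℝ) (hx : x ∈ Icc (0:ℝ) 1) :
    ‖pi1 l φ x‖ₑ ≤ kC l * ∫⁻ s in Ioo (0:ℝ) 1, ‖φ s‖ₑ := by
  unfold pi1
  refine (enorm_integral_le_lintegral_enorm _).trans ?_
  rw [← lintegral_const_mul' _ _ ENNReal.coe_ne_top]
  apply setLIntegral_mono' measurableSet_Ioo
  intro s hs
  rw [enorm_mul]
  gcongr
  exact kC_spec l x s hx (Ioo_subset_Icc_self hs)

lemma pi1_poly (l : ℕ) (a : ℕ → ℝ) (x : ℝ) :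
    pi1 l (fun s => ∑ i ∈ Finset.range (l + 1), a i * s ^ i) x =
      ∑ i ∈ Finset.range (l + 1), a i * x ^ i := by
  unfold pi1
  simp_rw [Finset.mul_sum]
  have hk := ker1_cont_right l x
  rw [integral_finsetSum _ (fun i _ => intOn_cont _ (by fun_prop))]
  refine Finset.sum_congr rfl fun i hi => ?_
  rw [← ker1_repro l i (by simpa [Nat.lt_succ_iff] using hi) x, ← integral_const_mul]
  congr 1; funext s; ring

lemma pi1_sub (l : ℕ) (φ ψ : ℝ → ℝ) (hφ : Continuous φ) (hψ : Continuous ψ) (x : ℝ) :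
    pi1 l (fun s => φ s - ψ s) x = pi1 l φ x - pi1 l ψ x := by
  unfold pi1
  have hk := ker1_cont_right l x
  rw [← integral_sub (intOn_cont _ (by fun_prop)) (intOn_cont _ (by fun_prop))]
  congr 1; funext s; ring

lemma pi1_est (l : ℕ) : ∃ C : ℝ≥0, ∀ φ : ℝ → ℝ, ContDiff ℝ (⊤ : ℕ∞) φ →
    ∫⁻ x in Ioo (0:ℝ) 1, ‖φ x - pi1 l φ x‖ₑ ≤ C * ∫⁻ ξ in Icc (-1:ℝ) 1, Wf (l + 1) φ ξ := by
  obtain ⟨C, hC⟩ := whitney1 l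
  refine ⟨(1 + kC l) * C, fun φ hφ => ?_⟩
  have hc := hφ.continuous
  have hne : (((1 + kC l : ℝ≥0)) : ℝ≥0∞) ≠ 0 := by
    simp
  have key := hC φ hφ ((((1 + kC l : ℝ≥0)) : ℝ≥0∞)⁻¹ * ∫⁻ x in Ioo (0:ℝ) 1, ‖φ x - pi1 l φ x‖ₑ) (by
    intro a
    rw [ENNReal.inv_mul_le_iff hne ENNReal.coe_ne_top]
    push_cast
    rw [add_mul, one_mul]
    calc ∫⁻ x in Ioo (0:ℝ) 1, ‖φ x - pi1 l φ x‖ₑ ≤ ∫⁻ x in Ioo (0:ℝ) 1,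
          (‖φ x - ∑ i ∈ Finset.range (l + 1), a i * x ^ i‖ₑ +
          kC l * ∫⁻ x in Ioo (0:ℝ) 1, ‖φ x - ∑ i ∈ Finset.range (l + 1), a i * x ^ i‖ₑ) := by
          apply setLIntegral_mono' measurableSet_Ioo
          intro x hx
          have h1 := pi1_sub l φ (fun s => ∑ i ∈ Finset.range (l + 1), a i * s ^ i) hc (by fun_prop) x
          rw [pi1_poly] at h1
          have h2 : φ x - pi1 l φ x = (φ x - ∑ i ∈ Finset.range (l + 1), a i * x ^ i) -
            pi1 l (fun s => φ s - ∑ i ∈ Finset.range (l + 1), a i * s ^ i) x := by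
            rw [h1]; ring
          rw [h2]
          refine (enorm_sub_le).trans ?_
          gcongr
          exact pi1_bound l _ x (Ioo_subset_Icc_self hx)
      _ = _ := by
          rw [lintegral_add_right _ measurable_const]
          simp)
  rw [ENNReal.inv_mul_le_iff hne ENNReal.coe_ne_top] at key
  rw [ENNReal.coe_mul, mul_assoc]
  exact key

end NBExt

namespace NBExt

/-- Lebesgue measure on the unit interval -/
def mu1 : Measure ℝ := volume.restrict (Ioo (0:ℝ) 1)

instance mu1_prob : IsProbabilityMeasure mu1 := ⟨by simp [mu1]⟩

/-- Lebesgue measure on the unit cube -/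
def mu (d : ℕ) : Measure (Fin d → ℝ) := Measure.pi fun _ => mu1

instance mu_prob (d : ℕ) : IsProbabilityMeasure (mu d) := by unfold mu; infer_instance

/-- the unit cube -/
def cub (d : ℕ) : Set (Fin d → ℝ) := Set.univ.pi fun _ => Ioo (0:ℝ) 1

lemma cub_meas (d : ℕ) : MeasurableSet (cub d) := MeasurableSet.univ_pi fun _ => measurableSet_Ioo

lemma mu_eq (d : ℕ) : mu d = volume.restrict (cub d) := by
  unfold mu mu1 cub
  rw [volume_pi, Measure.restrict_pi_pi]

lemma ae_mu (d : ℕ) : ∀ᵐ x ∂mu d, x ∈ cub d := by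
  rw [mu_eq]; exact ae_restrict_mem (cub_meas d)

lemma upd_mp {d : ℕ} (j : Fin d) :
    MeasurePreserving (fun q : (Fin d → ℝ) × ℝ => update q.1 j q.2) ((mu d).prod mu1) (mu d) := by
  refine ⟨measurable_update', ?_⟩
  symm
  unfold mu
  apply Measure.pi_eq
  intro s hs
  rw [Measure.map_apply measurable_update' (MeasurableSet.univ_pi hs)]
  have h1 : (fun q : (Fin d → ℝ) × ℝ => update q.1 j q.2) ⁻¹' univ.pi s =
      (univ.pi (update s j univ)) ×ˢ s j := by
    ext q
    simp only [mem_preimage, mem_univ_pi, mem_prod]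
    constructor
    · intro h
      refine ⟨fun i => ?_, by simpa using h j⟩
      by_cases hi : i = j
      · subst hi; simp
      · simpa [hi] using h i
    · intro h i
      by_cases hi : i = j
      · subst hi; simpa using h.2
      · simpa [hi] using h.1 i
  rw [h1, Measure.prod_prod, Measure.pi_pi, ← Finset.mul_prod_erase _ _ (Finset.mem_univ j),
    ← Finset.mul_prod_erase _ (fun i => mu1 (s i)) (Finset.mem_univ j)]
  simp only [update_self, measure_univ, one_mul]
  rw [mul_comm]
  congr 1
  refine Finset.prod_congr rfl fun i hi => ?_
  rw [update_of_ne (Finset.ne_of_mem_erase hi)]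

lemma lint_upd {d : ℕ} (j : Fin d) (h : (Fin d → ℝ) → ℝ≥0∞) (hm : Measurable h) :
    ∫⁻ x, ∫⁻ s, h (update x j s) ∂mu1 ∂mu d = ∫⁻ x, h x ∂mu d := by
  rw [← (upd_mp j).lintegral_comp hm, lintegral_prod]
  exact (hm.comp measurable_update').aemeasurable

lemma upd_cub {d : ℕ} (j : Fin d) (x : Fin d → ℝ) (hx : x ∈ cub d) (s : ℝ) (hs : s ∈ Ioo (0:ℝ) 1) :
    update x j s ∈ cub d := by
  intro i _
  by_cases hi : i = j
  · subst hi; simpa using hs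
  · simpa [hi] using hx i (mem_univ i)

def difj {d : ℕ} (j : Fin d) (k : ℕ) (ξ : ℝ) (f : (Fin d → ℝ) → ℝ) (x : Fin d → ℝ) : ℝ :=
  dif k ξ (fun t => f (update x j t)) (x j)

def Dj {d : ℕ} (j : Fin d) (k : ℕ) (ξ : ℝ) : Set (Fin d → ℝ) := {x | x j + k * ξ ∈ Ioo (0:ℝ) 1}

lemma Dj_meas2 {d : ℕ} (j : Fin d) (k : ℕ) :
    MeasurableSet {q : (Fin d → ℝ) × ℝ | q.1 ∈ Dj j k q.2} := by
  have : Measurable fun q : (Fin d → ℝ) × ℝ => q.1 j + k * q.2 := by fun_prop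
  exact this measurableSet_Ioo

lemma Dj_meas {d : ℕ} (j : Fin d) (k : ℕ) (ξ : ℝ) : MeasurableSet (Dj j k ξ) := by
  have : Measurable fun q : (Fin d → ℝ) => q j + k * ξ := by fun_prop
  exact this measurableSet_Ioo

lemma difj_meas2 {d : ℕ} (j : Fin d) (k : ℕ) (f : (Fin d → ℝ) → ℝ) (hf : Measurable f) :
    Measurable fun q : (Fin d → ℝ) × ℝ => difj j k q.2 f q.1 := by
  unfold difj dif
  refine Finset.measurable_fun_sum _ fun i _ => ?_
  apply Measurable.const_mul
  apply hf.comp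
  exact measurable_update'.comp (by fun_prop : Measurable fun q : (Fin d → ℝ) × ℝ =>
    (q.1, q.1 j + i * q.2))

lemma difj_meas {d : ℕ} (j : Fin d) (k : ℕ) (ξ : ℝ) (f : (Fin d → ℝ) → ℝ) (hf : Measurable f) :
    Measurable fun x : (Fin d → ℝ) => difj j k ξ f x :=
  (difj_meas2 j k f hf).comp (by fun_prop : Measurable fun x : (Fin d → ℝ) => (x, ξ))

def Eint {d : ℕ} (j : Fin d) (k : ℕ) (p : ℝ) (ξ : ℝ) (f : (Fin d → ℝ) → ℝ) : ℝ≥0∞ :=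
  ∫⁻ x in Dj j k ξ, ‖difj j k ξ f x‖ₑ ^ p ∂mu d

def Rint {d : ℕ} (j : Fin d) (k : ℕ) (p : ℝ) (f : (Fin d → ℝ) → ℝ) : ℝ≥0∞ :=
  ∫⁻ ξ in Icc (-1:ℝ) 1, Eint j k p ξ f

def Pj {d : ℕ} (j : Fin d) (l : ℕ) (f : (Fin d → ℝ) → ℝ) (x : Fin d → ℝ) : ℝ :=
  pi1 l (fun t => f (update x j t)) (x j)

/-- indicator form of the integrand -/
def Hj {d : ℕ} (j : Fin d) (k : ℕ) (p : ℝ) (f : (Fin d → ℝ) → ℝ) (q : (Fin d → ℝ) × ℝ) : ℝ≥0∞ :=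
  {q : (Fin d → ℝ) × ℝ | q.1 ∈ Dj j k q.2}.indicator (fun q => ‖difj j k q.2 f q.1‖ₑ ^ p) q

lemma Hj_meas {d : ℕ} (j : Fin d) (k : ℕ) (p : ℝ) (f : (Fin d → ℝ) → ℝ) (hf : Measurable f) :
    Measurable (Hj j k p f) :=
  Measurable.indicator ((difj_meas2 j k f hf).enorm.pow_const p) (Dj_meas2 j k)

lemma Eint_eq {d : ℕ} (j : Fin d) (k : ℕ) (p : ℝ) (ξ : ℝ) (f : (Fin d → ℝ) → ℝ) :
    Eint j k p ξ f = ∫⁻ x, Hj j k p f (x, ξ) ∂mu d := by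
  unfold Eint
  rw [← lintegral_indicator (Dj_meas j k ξ)]
  rfl

lemma Wf_slice {d : ℕ} (j : Fin d) (k : ℕ) (ξ : ℝ) (f : (Fin d → ℝ) → ℝ) (x : Fin d → ℝ) :
    Wf k (fun t => f (update x j t)) ξ = ∫⁻ s, Hj j k 1 f (update x j s, ξ) ∂mu1 := by
  unfold Wf mu1
  have h1 : dom k ξ = {s : ℝ | s + k * ξ ∈ Ioo (0:ℝ) 1} ∩ Ioo 0 1 := by
    ext s; simp only [dom, mem_ofPred_eq, mem_inter_iff]; tauto
  have hm : MeasurableSet {s : ℝ | s + k * ξ ∈ Ioo (0:ℝ) 1} :=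
    (by fun_prop : Measurable fun s : ℝ => s + k * ξ) measurableSet_Ioo
  rw [h1, ← Measure.restrict_restrict hm, ← lintegral_indicator hm]
  congr 1; funext s
  simp only [indicator, Hj, Dj, mem_ofPred_eq, update_self, difj, update_idem, ENNReal.rpow_one]

lemma slice_est {d : ℕ} (j : Fin d) (l : ℕ) : ∃ C : ℝ≥0, ∀ f : (Fin d → ℝ) → ℝ, Continuous f →
    (∀ x, ContDiff ℝ (⊤ : ℕ∞) fun t => f (update x j t)) → Measurable (Pj j l f) →
    ∫⁻ x, ‖f x - Pj j l f x‖ₑ ∂mu d ≤ C * Rint j (l + 1) 1 f := by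
  obtain ⟨C, hC⟩ := pi1_est l
  refine ⟨C, fun f hf hs hm => ?_⟩
  change ∫⁻ x, ‖(f - Pj j l f) x‖ₑ ∂mu d ≤ _
  rw [← lint_upd j _ (hf.measurable.sub hm).enorm]
  have h1 : ∀ x, ∫⁻ s, ‖(f - Pj j l f) (update x j s)‖ₑ ∂mu1 ≤
      C * ∫⁻ ξ in Icc (-1:ℝ) 1, ∫⁻ s, Hj j (l + 1) 1 f (update x j s, ξ) ∂mu1 := by
    intro x
    refine le_trans (le_of_eq ?_) ((hC _ (hs x)).trans (le_of_eq ?_))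
    · simp only [Pi.sub_apply, Pj, update_self, update_idem, mu1]
    · simp_rw [Wf_slice]
  refine (lintegral_mono h1).trans (le_of_eq ?_)
  have hH := Hj_meas j (l + 1) 1 f hf.measurable
  rw [lintegral_const_mul' _ _ ENNReal.coe_ne_top]
  congr 1
  rw [lintegral_lintegral_swap]
  · unfold Rint
    congr 1; funext ξ
    rw [Eint_eq, ← lint_upd j (fun x => Hj j (l + 1) 1 f (x, ξ)) (hH.comp (by fun_prop))]
  · apply Measurable.aemeasurable
    apply Measurable.lintegral_prod_right' (f := fun q : ((Fin d → ℝ) × ℝ) × ℝ =>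
      Hj j (l + 1) 1 f (update q.1.1 j q.2, q.1.2))
    apply hH.comp
    apply Measurable.prodMk
    · exact measurable_update'.comp (by fun_prop : Measurable fun q : ((Fin d → ℝ) × ℝ) × ℝ =>
        (q.1.1, q.2))
    · fun_prop

end NBExt

namespace NBExt

lemma pi1_eq (l : ℕ) (φ : ℝ → ℝ) (hφ : Continuous φ) (x : ℝ) :
    pi1 l φ x = ∑ i : Fin (l + 1), (∑ j : Fin (l + 1), kerA l i j *
      ∫ s in Ioo (0:ℝ) 1, s ^ (j : ℕ) * φ s) * x ^ (i : ℕ) := by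
  unfold pi1 ker1
  simp_rw [Finset.sum_mul]
  rw [integral_finsetSum _ (fun i _ => intOn_cont _ (by fun_prop))]
  refine Finset.sum_congr rfl fun i _ => ?_
  rw [integral_finsetSum _ (fun i _ => intOn_cont _ (by fun_prop))]
  refine Finset.sum_congr rfl fun j _ => ?_
  rw [← integral_const_mul, ← integral_mul_const]
  congr 1; funext s; ring

lemma pi1_smooth (l : ℕ) (φ : ℝ → ℝ) (hφ : Continuous φ) : ContDiff ℝ (⊤ : ℕ∞) (pi1 l φ) := by
  have : pi1 l φ = fun x => _ := funext fun x => pi1_eq l φ hφ x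
  rw [this]
  fun_prop

/-- finite sums of products of functions of one variable -/
def sepF {d : ℕ} {ι : Type} [Fintype ι] (c : ι → Fin d → ℝ → ℝ) (x : Fin d → ℝ) : ℝ :=
  ∑ a, ∏ i, c a i (x i)

lemma sepF_cont {d : ℕ} {ι : Type} [Fintype ι] (c : ι → Fin d → ℝ → ℝ)
    (hc : ∀ a i, Continuous (c a i)) : Continuous (sepF c) := by
  unfold sepF
  refine continuous_finsetSum _ fun a _ => continuous_finsetProd _ fun i _ => ?_
  exact (hc a i).comp (continuous_apply i)

lemma sepF_slice {d : ℕ} {ι : Type} [Fintype ι] (c : ι → Fin d → ℝ → ℝ) (j : Fin d)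
    (x : Fin d → ℝ) (t : ℝ) : sepF c (update x j t) =
      ∑ a, c a j t * ∏ i ∈ Finset.univ.erase j, c a i (x i) := by
  unfold sepF
  refine Finset.sum_congr rfl fun a _ => ?_
  rw [← Finset.mul_prod_erase _ _ (Finset.mem_univ j), update_self]
  congr 1
  refine Finset.prod_congr rfl fun i hi => ?_
  rw [update_of_ne (Finset.ne_of_mem_erase hi)]

lemma sepF_slice_smooth {d : ℕ} {ι : Type} [Fintype ι] (c : ι → Fin d → ℝ → ℝ)
    (hc : ∀ a i, ContDiff ℝ (⊤ : ℕ∞) (c a i)) (j : Fin d) (x : Fin d → ℝ) :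
    ContDiff ℝ (⊤ : ℕ∞) fun t => sepF c (update x j t) := by
  simp_rw [sepF_slice]
  refine ContDiff.sum fun a _ => ?_
  exact (hc a j).mul contDiff_const

lemma Pj_sepF {d : ℕ} {ι : Type} [Fintype ι] (c : ι → Fin d → ℝ → ℝ)
    (hc : ∀ a i, Continuous (c a i)) (j : Fin d) (l : ℕ) :
    Pj j l (sepF c) = sepF fun a => update (c a) j (pi1 l (c a j)) := by
  funext x
  have h1 := sepF_slice (fun a => update (c a) j (pi1 l (c a j))) j x (x j)
  rw [update_eq_self] at h1
  rw [h1]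
  unfold Pj
  simp_rw [sepF_slice]
  unfold pi1
  simp_rw [Finset.mul_sum]
  have hk := ker1_cont_right l (x j)
  rw [integral_finsetSum _ (fun a _ => intOn_cont _ (by have := hc a j; fun_prop))]
  refine Finset.sum_congr rfl fun a _ => ?_
  rw [update_self, ← integral_mul_const]
  have h2 : ∏ i ∈ Finset.univ.erase j, update (c a) j
      (fun x => ∫ (s : ℝ) in Ioo 0 1, ker1 l x s * c a j s) i (x i) =
      ∏ i ∈ Finset.univ.erase j, c a i (x i) := by
    refine Finset.prod_congr rfl fun i hi => ?_
    rw [update_of_ne (Finset.ne_of_mem_erase hi)]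
  rw [h2]
  congr 1; funext s; ring

lemma Pj_bound {d : ℕ} (j : Fin d) (l : ℕ) (f : (Fin d → ℝ) → ℝ) (x : Fin d → ℝ) (hx : x ∈ cub d) :
    ‖Pj j l f x‖ₑ ≤ kC l * ∫⁻ s, ‖f (update x j s)‖ₑ ∂mu1 :=
  pi1_bound l _ _ (Ioo_subset_Icc_self (hx j (mem_univ j)))

/-- the full projection on the unit cube -/
def Kop {d : ℕ} (l : Fin d → ℕ) (f : (Fin d → ℝ) → ℝ) (x : Fin d → ℝ) : ℝ :=
  ∫ y, (∏ j, ker1 (l j) (x j) (y j)) * f y ∂mu d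

lemma mu1_int (φ : ℝ → ℝ) (hφ : Continuous φ) : Integrable φ mu1 := intOn_cont φ hφ

lemma Kop_sepF {d : ℕ} {ι : Type} [Fintype ι] (c : ι → Fin d → ℝ → ℝ)
    (hc : ∀ a i, Continuous (c a i)) (l : Fin d → ℕ) :
    Kop l (sepF c) = sepF fun a i => pi1 (l i) (c a i) := by
  funext x
  unfold Kop sepF mu
  simp_rw [Finset.mul_sum, ← Finset.prod_mul_distrib]
  rw [integral_finsetSum]
  · refine Finset.sum_congr rfl fun a _ => ?_
    rw [integral_fintype_prod_eq_prod (fun i s => ker1 (l i) (x i) s * c a i s)]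
    rfl
  · intro a _
    apply Integrable.fintype_prod (f := fun i s => ker1 (l i) (x i) s * c a i s)
    intro i
    exact mu1_int _ ((ker1_cont_right (l i) (x i)).mul (hc a i))

lemma sep_ind {d : ℕ} (l : Fin d → ℕ) (s : Finset (Fin d)) : ∃ C : ℝ≥0,
    ∀ (ι : Type) [Fintype ι] (c : ι → Fin d → ℝ → ℝ), (∀ a i, ContDiff ℝ (⊤ : ℕ∞) (c a i)) →
    ∫⁻ x, ‖sepF c x - sepF (fun a i => if i ∈ s then pi1 (l i) (c a i) else c a i) x‖ₑ ∂mu d ≤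
      C * ∑ j ∈ s, Rint j (l j + 1) 1 (sepF c) := by
  induction s using Finset.induction_on with
  | empty => exact ⟨0, fun ι _ c hc => by simp⟩
  | insert j s hj ih =>
    obtain ⟨C, hC⟩ := ih
    obtain ⟨C', hC'⟩ := slice_est j (l j)
    refine ⟨C' + kC (l j) * C, fun ι _ c hc => ?_⟩
    have hcc : ∀ a i, Continuous (c a i) := fun a i => (hc a i).continuous
    set c' : ι → Fin d → ℝ → ℝ := fun a i => if i ∈ s then pi1 (l i) (c a i) else c a i with hc'
    have hc's : ∀ a i, Continuous (c' a i) := by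
      intro a i
      simp only [hc']
      split_ifs
      · exact (pi1_smooth _ _ (hcc a i)).continuous
      · exact hcc a i
    have e1 : sepF (fun a i => if i ∈ insert j s then pi1 (l i) (c a i) else c a i) =
        Pj j (l j) (sepF c') := by
      rw [Pj_sepF c' hc's]
      congr 1; funext a i
      by_cases hi : i = j
      · subst hi; simp [hc', hj]
      · simp [hc', hi]
    rw [e1]
    have e2 : ∀ x ∈ cub d, ‖sepF c x - Pj j (l j) (sepF c') x‖ₑ ≤
        ‖sepF c x - Pj j (l j) (sepF c) x‖ₑ + kC (l j) *
          ∫⁻ s, ‖sepF c (update x j s) - sepF c' (update x j s)‖ₑ ∂mu1 := by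
      intro x hx
      have h1 : Pj j (l j) (fun x => sepF c x - sepF c' x) x =
        Pj j (l j) (sepF c) x - Pj j (l j) (sepF c') x := by
        unfold Pj
        have := sepF_cont c hcc
        have := sepF_cont c' hc's
        apply pi1_sub
        · fun_prop
        · fun_prop
      have h2 : sepF c x - Pj j (l j) (sepF c') x = (sepF c x - Pj j (l j) (sepF c) x) +
        Pj j (l j) (fun x => sepF c x - sepF c' x) x := by rw [h1]; ring
      rw [h2]
      refine (enorm_add_le _ _).trans ?_
      gcongr
      exact Pj_bound j (l j) _ x hx
    have hPm : Measurable (Pj j (l j) (sepF c)) := by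
      rw [Pj_sepF c hcc]
      apply Continuous.measurable
      apply sepF_cont
      intro a i
      by_cases hi : i = j
      · subst hi; simpa using (pi1_smooth _ _ (hcc a i)).continuous
      · simpa [hi] using hcc a i
    have hm2 := ((sepF_cont c hcc).sub (sepF_cont c' hc's)).measurable
    refine (lintegral_mono_ae ((ae_mu d).mono e2)).trans ?_
    have hm3 : Measurable fun a => ‖sepF c a - Pj j (l j) (sepF c) a‖ₑ :=
      ((sepF_cont c hcc).measurable.sub hPm).enorm
    rw [lintegral_add_left hm3,
      lintegral_const_mul' _ _ ENNReal.coe_ne_top,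
      lint_upd j (fun x => ‖sepF c x - sepF c' x‖ₑ) hm2.enorm, Finset.sum_insert hj]
    have h5 := hC' (sepF c) (sepF_cont c hcc) (sepF_slice_smooth c hc j) hPm
    have h6 := hC ι c hc
    calc _ ≤ C' * Rint j (l j + 1) 1 (sepF c) + kC (l j) *
          (C * ∑ j ∈ s, Rint j (l j + 1) 1 (sepF c)) := by gcongr
      _ ≤ (C' + kC (l j) * C) * Rint j (l j + 1) 1 (sepF c) + (C' + kC (l j) * C) *
          ∑ j ∈ s, Rint j (l j + 1) 1 (sepF c) := by
          rw [← mul_assoc]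
          gcongr
          · exact le_self_add
          · exact le_add_self
      _ = _ := by push_cast; ring

lemma sep_est {d : ℕ} (l : Fin d → ℕ) : ∃ C : ℝ≥0,
    ∀ (ι : Type) [Fintype ι] (c : ι → Fin d → ℝ → ℝ), (∀ a i, ContDiff ℝ (⊤ : ℕ∞) (c a i)) →
    ∫⁻ x, ‖sepF c x - Kop l (sepF c) x‖ₑ ∂mu d ≤
      C * ∑ j, Rint j (l j + 1) 1 (sepF c) := by
  obtain ⟨C, hC⟩ := sep_ind l Finset.univ
  refine ⟨C, fun ι _ c hc => ?_⟩
  have := hC ι c hc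
  simp only [Finset.mem_univ, if_true] at this
  rw [Kop_sepF c (fun a i => (hc a i).continuous)]
  exact this

end NBExt

namespace NBExt

/-- product kernel -/
def kerd {d : ℕ} (l : Fin d → ℕ) (x y : Fin d → ℝ) : ℝ := ∏ j, ker1 (l j) (x j) (y j)

lemma kerd_cont {d : ℕ} (l : Fin d → ℕ) :
    Continuous fun q : (Fin d → ℝ) × (Fin d → ℝ) => kerd l q.1 q.2 := by
  unfold kerd
  refine continuous_finsetProd _ fun j _ => ?_
  exact (ker1_cont (l j)).comp (by fun_prop : Continuous fun q : (Fin d → ℝ) × (Fin d → ℝ) =>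
    (q.1 j, q.2 j))

lemma kerd_cont_right {d : ℕ} (l : Fin d → ℕ) (x : Fin d → ℝ) :
    Continuous fun y : (Fin d → ℝ) => kerd l x y := by
  unfold kerd
  exact continuous_finsetProd _ fun j _ => (ker1_cont_right (l j) (x j)).comp (continuous_apply j)

lemma kerd_symm {d : ℕ} (l : Fin d → ℕ) (x y : Fin d → ℝ) : kerd l x y = kerd l y x := by
  unfold kerd
  exact Finset.prod_congr rfl fun j _ => ker1_symm (l j) (x j) (y j)

def kCd {d : ℕ} (l : Fin d → ℕ) : ℝ≥0 := ∏ j, kC (l j)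

lemma kerd_bound {d : ℕ} (l : Fin d → ℕ) (x y : Fin d → ℝ) (hx : x ∈ cub d) (hy : y ∈ cub d) :
    ‖kerd l x y‖ₑ ≤ kCd l := by
  have : ‖kerd l x y‖₊ ≤ kCd l := by
    unfold kerd kCd
    rw [nnnorm_prod]
    refine Finset.prod_le_prod' fun j _ => ?_
    have := kC_spec (l j) (x j) (y j) (Ioo_subset_Icc_self (hx j (mem_univ j)))
      (Ioo_subset_Icc_self (hy j (mem_univ j)))
    rw [enorm_eq_nnnorm] at this
    exact_mod_cast this
  rw [enorm_eq_nnnorm]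
  exact_mod_cast this

lemma Kop_bound {d : ℕ} (l : Fin d → ℕ) (f : (Fin d → ℝ) → ℝ) (x : Fin d → ℝ) (hx : x ∈ cub d) :
    ‖Kop l f x‖ₑ ≤ kCd l * ∫⁻ y, ‖f y‖ₑ ∂mu d := by
  unfold Kop
  refine (enorm_integral_le_lintegral_enorm _).trans ?_
  rw [← lintegral_const_mul' _ _ ENNReal.coe_ne_top]
  apply lintegral_mono_ae
  filter_upwards [ae_mu d] with y hy
  rw [enorm_mul]
  gcongr
  exact kerd_bound l x y hx hy

lemma cont_bdd {d : ℕ} (g : (Fin d → ℝ) → ℝ) (hg : Continuous g) :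
    ∃ C : ℝ, ∀ y ∈ cub d, ‖g y‖ ≤ C := by
  have hK : IsCompact (Set.univ.pi fun _ : Fin d => Icc (0:ℝ) 1) :=
    isCompact_univ_pi fun _ => isCompact_Icc
  obtain ⟨C, hC⟩ := hK.exists_bound_of_continuousOn hg.continuousOn
  refine ⟨C, fun y hy => hC y ?_⟩
  intro i hi
  exact Ioo_subset_Icc_self (hy i hi)

lemma int_cont_mul {d : ℕ} (g f : (Fin d → ℝ) → ℝ) (hg : Continuous g) (hf : Integrable f (mu d)) :
    Integrable (fun y => g y * f y) (mu d) := by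
  obtain ⟨C, hC⟩ := cont_bdd g hg
  apply hf.bdd_mul (c := C) hg.aestronglyMeasurable
  filter_upwards [ae_mu d] with y hy using hC y hy

lemma Kop_sub {d : ℕ} (l : Fin d → ℕ) (f g : (Fin d → ℝ) → ℝ) (hf : Integrable f (mu d))
    (hg : Integrable g (mu d)) (x : Fin d → ℝ) :
    Kop l (fun y => f y - g y) x = Kop l f x - Kop l g x := by
  change ∫ y, kerd l x y * (f y - g y) ∂mu d =
    (∫ y, kerd l x y * f y ∂mu d) - ∫ y, kerd l x y * g y ∂mu d
  rw [← integral_sub (int_cont_mul _ f (kerd_cont_right l x) hf)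
    (int_cont_mul _ g (kerd_cont_right l x) hg)]
  congr 1; funext y; ring

lemma kerd_expand {d : ℕ} (l : Fin d → ℕ) (x y : Fin d → ℝ) : kerd l x y =
    ∑ k : (∀ j : Fin d, Fin (l j + 1)), (∏ j, ∑ m : Fin (l j + 1), kerA (l j) (k j) m * y j ^ (m : ℕ)) *
      ∏ j, x j ^ (k j : ℕ) := by
  unfold kerd
  have h1 : ∀ j, ker1 (l j) (x j) (y j) = ∑ i : Fin (l j + 1), (∑ m : Fin (l j + 1), kerA (l j) i m * y j ^ (m : ℕ)) *
      x j ^ (i : ℕ) := by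
    intro j
    unfold ker1
    refine Finset.sum_congr rfl fun i _ => ?_
    rw [Finset.sum_mul]
    refine Finset.sum_congr rfl fun m _ => ?_
    ring
  simp_rw [h1]
  rw [Finset.prod_univ_sum, Fintype.piFinset_univ]
  simp_rw [Finset.prod_mul_distrib]

lemma Kop_poly {d : ℕ} (l : Fin d → ℕ) (f : (Fin d → ℝ) → ℝ) (hf : Integrable f (mu d)) :
    IsPolyDeg l (Kop l f) := by
  refine ⟨fun k => ∫ y, (∏ j, ∑ m : Fin (l j + 1), kerA (l j) (k j) m * y j ^ (m : ℕ)) * f y ∂mu d,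
    fun x => ?_⟩
  change ∫ y, kerd l x y * f y ∂mu d = _
  simp_rw [kerd_expand, Finset.sum_mul]
  rw [integral_finsetSum]
  · refine Finset.sum_congr rfl fun k _ => ?_
    rw [← integral_mul_const]
    congr 1; funext y; ring
  · intro k _
    exact int_cont_mul _ f (by fun_prop) hf

lemma poly_cont {d : ℕ} (l : Fin d → ℕ) (f : (Fin d → ℝ) → ℝ) (hf : IsPolyDeg l f) :
    Continuous f := by
  obtain ⟨a, ha⟩ := hf
  rw [funext ha]
  fun_prop

lemma upd_add {d : ℕ} (j : Fin d) (x : Fin d → ℝ) (t : ℝ) :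
    update x j (x j + t) = x + Pi.single j t := by
  funext i
  by_cases hi : i = j
  · subst hi; simp
  · simp [hi]

lemma shift_cub {d : ℕ} (j : Fin d) (k i : ℕ) (hi : i ≤ k) (ξ : ℝ) (x : Fin d → ℝ)
    (hx : x ∈ cub d) (hx2 : x ∈ Dj j k ξ) : x + Pi.single j (i * ξ) ∈ cub d := by
  rw [← upd_add]
  apply upd_cub j x hx
  have h1 := hx j (mem_univ j)
  have h2 : x j + k * ξ ∈ Ioo (0:ℝ) 1 := hx2
  have hi' : (i : ℝ) ≤ k := by exact_mod_cast hi
  have hi0 : (0 : ℝ) ≤ i := by positivity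
  rcases le_total 0 ξ with h | h
  · have a1 : 0 ≤ (i:ℝ) * ξ := mul_nonneg hi0 h
    have a2 : (i:ℝ) * ξ ≤ k * ξ := mul_le_mul_of_nonneg_right hi' h
    exact ⟨by linarith [h1.1], by linarith [h2.2]⟩
  · have a1 : (i:ℝ) * ξ ≤ 0 := mul_nonpos_of_nonneg_of_nonpos hi0 h
    have a2 : (k:ℝ) * ξ ≤ i * ξ := mul_le_mul_of_nonpos_right hi' h
    exact ⟨by linarith [h2.1], by linarith [h1.2]⟩

lemma lint_shift {d : ℕ} (j : Fin d) (k i : ℕ) (hi : i ≤ k) (ξ : ℝ) (H : (Fin d → ℝ) → ℝ≥0∞) :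
    ∫⁻ x in Dj j k ξ, H (x + Pi.single j (i * ξ)) ∂mu d ≤ ∫⁻ x, H x ∂mu d := by
  rw [mu_eq, Measure.restrict_restrict (Dj_meas j k ξ), ← lintegral_indicator (cub_meas d),
    ← lintegral_indicator ((Dj_meas j k ξ).inter (cub_meas d)),
    ← lintegral_add_right_eq_self ((cub d).indicator fun x => H x) (Pi.single j (i * ξ))]
  apply lintegral_mono
  intro x
  simp only
  by_cases hx : x ∈ Dj j k ξ ∩ cub d
  · rw [indicator_of_mem hx, indicator_of_mem (shift_cub j k i hi ξ x hx.2 hx.1)]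
  · rw [indicator_of_notMem hx]; exact zero_le

lemma ae_shift {d : ℕ} (j : Fin d) (k i : ℕ) (hi : i ≤ k) (ξ : ℝ) (p : (Fin d → ℝ) → Prop)
    (hp : ∀ᵐ x ∂mu d, p x) : ∀ᵐ x ∂(mu d).restrict (Dj j k ξ), p (x + Pi.single j (i * ξ)) := by
  rw [mu_eq, ae_restrict_iff' (cub_meas d)] at hp
  rw [mu_eq, Measure.restrict_restrict (Dj_meas j k ξ),
    ae_restrict_iff' ((Dj_meas j k ξ).inter (cub_meas d))]
  have h2 := (measurePreserving_add_right (volume : Measure (Fin d → ℝ))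
    (Pi.single j (i * ξ))).quasiMeasurePreserving.ae hp
  filter_upwards [h2] with x hx hx2
  exact hx (shift_cub j k i hi ξ x hx2.2 hx2.1)

lemma Eint_congr {d : ℕ} (j : Fin d) (k : ℕ) (p : ℝ) (ξ : ℝ) (f g : (Fin d → ℝ) → ℝ)
    (h : f =ᵐ[mu d] g) : Eint j k p ξ f = Eint j k p ξ g := by
  unfold Eint
  apply lintegral_congr_ae
  have h1 : ∀ᵐ x ∂(mu d).restrict (Dj j k ξ), ∀ i ∈ Finset.range (k + 1),
      f (x + Pi.single j (i * ξ)) = g (x + Pi.single j (i * ξ)) := by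
    rw [Filter.eventually_all_finset]
    intro i hi
    exact ae_shift j k i (by simpa [Nat.lt_succ_iff] using hi) ξ (fun x => f x = g x) h
  filter_upwards [h1] with x hx
  have : difj j k ξ f x = difj j k ξ g x := by
    unfold difj dif
    refine Finset.sum_congr rfl fun i hi => ?_
    simp only [upd_add]
    rw [hx i hi]
  rw [this]

lemma Eint_bound {d : ℕ} (j : Fin d) (k : ℕ) (ξ : ℝ) (f : (Fin d → ℝ) → ℝ) (hf : Measurable f) :
    Eint j k 1 ξ f ≤ 2 ^ k * ∫⁻ x, ‖f x‖ₑ ∂mu d := by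
  unfold Eint
  simp only [ENNReal.rpow_one]
  have h1 : ∀ x, ‖difj j k ξ f x‖ₑ ≤ ∑ i ∈ Finset.range (k + 1),
      (k.choose i : ℝ≥0∞) * ‖f (x + Pi.single j (i * ξ))‖ₑ := by
    intro x
    unfold difj dif
    refine (enorm_sum_le _ _).trans (Finset.sum_le_sum fun i _ => ?_)
    simp only [upd_add]
    rw [enorm_mul, enorm_mul, enorm_pow, enorm_neg, enorm_one, one_pow, one_mul]
    gcongr
    rw [Real.enorm_eq_ofReal_abs, Nat.abs_cast, ENNReal.ofReal_natCast]
  refine (lintegral_mono h1).trans ?_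
  rw [lintegral_finsetSum]
  · calc _ ≤ ∑ i ∈ Finset.range (k + 1), (k.choose i : ℝ≥0∞) * ∫⁻ x, ‖f x‖ₑ ∂mu d := by
          refine Finset.sum_le_sum fun i hi => ?_
          rw [lintegral_const_mul' _ _ (ENNReal.natCast_ne_top _)]
          refine mul_le_mul_right ?_ _
          exact lint_shift j k i (by simpa [Nat.lt_succ_iff] using hi) ξ (fun x => ‖f x‖ₑ)
      _ = _ := by
          rw [← Finset.sum_mul]
          congr 1
          exact_mod_cast Nat.sum_range_choose k
  · intro i _
    apply Measurable.const_mul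
    exact (hf.comp (by fun_prop)).enorm

lemma Rint_pert {d : ℕ} (j : Fin d) (k : ℕ) (f g : (Fin d → ℝ) → ℝ) (hf : Measurable f)
    (hg : Measurable g) : Rint j k 1 g ≤ Rint j k 1 f + 2 ^ (k + 1) * ∫⁻ x, ‖f x - g x‖ₑ ∂mu d := by
  have h1 : ∀ ξ, Eint j k 1 ξ g ≤ Eint j k 1 ξ f + 2 ^ k * ∫⁻ x, ‖f x - g x‖ₑ ∂mu d := by
    intro ξ
    refine le_trans ?_ (add_le_add le_rfl (Eint_bound j k ξ (fun x => f x - g x) (hf.sub hg)))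
    unfold Eint
    simp only [ENNReal.rpow_one]
    rw [← lintegral_add_left (difj_meas j k ξ f hf).enorm]
    apply lintegral_mono
    intro x
    have : difj j k ξ g x = difj j k ξ f x - difj j k ξ (fun x => f x - g x) x := by
      unfold difj dif
      rw [← Finset.sum_sub_distrib]
      refine Finset.sum_congr rfl fun i _ => ?_
      ring
    simp only
    rw [this]
    exact enorm_sub_le
  unfold Rint
  refine (lintegral_mono h1).trans (le_of_eq ?_)
  rw [lintegral_add_right _ measurable_const]
  congr 1
  simp only [lintegral_const, MeasurableSet.univ, Measure.restrict_apply, univ_inter,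
    Real.volume_Icc]
  norm_num
  ring

end NBExt

namespace NBExt

lemma mvpoly_sepF {d : ℕ} (j0 : Fin d) (p : MvPolynomial (Fin d) ℝ) :
    ∃ (ι : Type) (_ : Fintype ι) (c : ι → Fin d → ℝ → ℝ), (∀ a i, ContDiff ℝ (⊤ : ℕ∞) (c a i)) ∧
      ∀ x, MvPolynomial.eval x p = sepF c x := by
  refine ⟨p.support, inferInstance, fun m i t => (if i = j0 then p.coeff m.1 else 1) * t ^ (m.1 i),
    fun a i => by fun_prop, fun x => ?_⟩
  rw [MvPolynomial.eval_eq']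
  unfold sepF
  simp_rw [Finset.prod_mul_distrib]
  simp only [Finset.prod_ite_eq', Finset.mem_univ, if_true]
  exact (Finset.sum_coe_sort p.support (fun m => p.coeff m * ∏ i, x i ^ m i)).symm

lemma sep_dense {d : ℕ} (j0 : Fin d) (f : (Fin d → ℝ) → ℝ) (hf : Integrable f (mu d)) (ε : ℝ≥0)
    (hε : 0 < ε) : ∃ (ι : Type) (_ : Fintype ι) (c : ι → Fin d → ℝ → ℝ),
      (∀ a i, ContDiff ℝ (⊤ : ℕ∞) (c a i)) ∧ ∫⁻ x, ‖f x - sepF c x‖ₑ ∂mu d ≤ ε := by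
  have : (mu d).Regular := by rw [mu_eq]; infer_instance
  obtain ⟨g, -, hg, hgc, -⟩ := hf.exists_hasCompactSupport_lintegral_sub_le
    (ε := ((ε / 2 : ℝ≥0) : ℝ≥0∞)) (by
      have : ε / 2 ≠ 0 := by positivity
      exact_mod_cast this)
  set X : Fin d → C(Fin d → ℝ, ℝ) := fun i => ⟨fun x => x i, continuous_apply i⟩ with hX
  have hsep : (MvPolynomial.aeval (R := ℝ) X).range.SeparatesPoints := by
    intro x y hxy
    obtain ⟨i, hi⟩ := Function.ne_iff.1 hxy
    refine ⟨X i, ⟨X i, ⟨MvPolynomial.X i, by simp⟩, rfl⟩, hi⟩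
  have hK : IsCompact (Set.univ.pi fun _ : Fin d => Icc (0:ℝ) 1) :=
    isCompact_univ_pi fun _ => isCompact_Icc
  obtain ⟨q, ⟨p, hp⟩, hq⟩ :=
    ContinuousMap.exists_mem_subalgebra_near_continuous_of_isCompact_of_separatesPoints hsep
    ⟨g, hgc⟩ hK (ε := ((ε / 2 : ℝ≥0) : ℝ)) (by positivity)
  obtain ⟨ι, hι, c, hc, hcp⟩ := mvpoly_sepF j0 p
  refine ⟨ι, hι, c, hc, ?_⟩
  have hev : ∀ x, q x = sepF c x := by
    intro x
    rw [← hcp x, ← hp]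
    have h1 := MvPolynomial.comp_aeval_apply (R := ℝ) (f := X)
      (ContinuousMap.evalAlgHom ℝ ℝ x) p
    have h2 : (ContinuousMap.evalAlgHom ℝ ℝ x) ((MvPolynomial.aeval X) p) =
      (MvPolynomial.aeval X p : C(Fin d → ℝ, ℝ)) x := rfl
    rw [h2] at h1
    refine h1.trans ?_
    rw [← MvPolynomial.aeval_eq_eval]
    rfl
  have h3 : ∀ x ∈ cub d, ‖f x - sepF c x‖ₑ ≤ ‖f x - g x‖ₑ + ((ε / 2 : ℝ≥0) : ℝ≥0∞) := by
    intro x hx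
    have h4 := (hq x (fun i hi => Ioo_subset_Icc_self (hx i hi))).le
    rw [hev x] at h4
    have h5 : ‖g x - sepF c x‖ₑ ≤ ((ε / 2 : ℝ≥0) : ℝ≥0∞) := by
      rw [enorm_eq_nnnorm, ENNReal.coe_le_coe, ← NNReal.coe_le_coe, coe_nnnorm, norm_sub_rev]
      exact h4
    refine le_trans ?_ (add_le_add le_rfl h5)
    refine le_trans (le_of_eq ?_) (enorm_add_le _ _)
    congr 1; ring
  refine (lintegral_mono_ae ((ae_mu d).mono h3)).trans ?_
  rw [lintegral_add_right _ measurable_const]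
  simp only [lintegral_const, measure_univ, mul_one]
  refine (add_le_add hg le_rfl).trans (le_of_eq ?_)
  rw [← ENNReal.coe_add, add_halves]

lemma cont_int {d : ℕ} (g : (Fin d → ℝ) → ℝ) (hg : Continuous g) : Integrable g (mu d) := by
  have := int_cont_mul g (fun _ => 1) hg (integrable_const 1)
  simpa using this

lemma l1_est {d : ℕ} (j0 : Fin d) (l : Fin d → ℕ) : ∃ C : ℝ≥0, ∀ f : (Fin d → ℝ) → ℝ, Measurable f →
    Integrable f (mu d) → ∫⁻ x, ‖f x - Kop l f x‖ₑ ∂mu d ≤ C * ∑ j, Rint j (l j + 1) 1 f := by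
  obtain ⟨C, hC⟩ := sep_est l
  refine ⟨C, fun f hfm hf => ?_⟩
  apply ENNReal.le_of_forall_pos_le_add
  intro ε hε _
  set M : ℝ≥0 := 1 + C * ∑ j : Fin d, 2 ^ (l j + 1 + 1) + kCd l with hM
  have hM0 : 0 < M := by positivity
  obtain ⟨ι, _, c, hc, hq⟩ := sep_dense j0 f hf (ε / M) (by positivity)
  set q := sepF c with hqd
  have hqc : Continuous q := sepF_cont c fun a i => (hc a i).continuous
  have hqi : Integrable q (mu d) := cont_int q hqc
  set e : ℝ≥0∞ := ∫⁻ x, ‖f x - q x‖ₑ ∂mu d with he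
  have h1 : ∀ x ∈ cub d, ‖f x - Kop l f x‖ₑ ≤ ‖f x - q x‖ₑ + ‖q x - Kop l q x‖ₑ + kCd l * e := by
    intro x hx
    have h2 := Kop_bound l (fun y => f y - q y) x hx
    rw [Kop_sub l f q hf hqi] at h2
    refine le_trans ?_ (add_le_add le_rfl h2)
    have h3 : f x - Kop l f x = ((f x - q x) + (q x - Kop l q x)) - (Kop l f x - Kop l q x) := by ring
    rw [h3]
    refine enorm_sub_le.trans ?_
    gcongr
    exact enorm_add_le _ _
  have hm1 : Measurable fun x => ‖f x - q x‖ₑ := (hfm.sub hqc.measurable).enorm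
  calc _ ≤ ∫⁻ x, (‖f x - q x‖ₑ + ‖q x - Kop l q x‖ₑ + kCd l * e) ∂mu d :=
        lintegral_mono_ae ((ae_mu d).mono h1)
    _ = e + (∫⁻ x, ‖q x - Kop l q x‖ₑ ∂mu d) + kCd l * e := by
        rw [lintegral_add_right _ measurable_const, lintegral_add_left hm1]
        simp only [lintegral_const, measure_univ, mul_one]
        rw [he]
    _ ≤ e + C * ∑ j, (Rint j (l j + 1) 1 f + 2 ^ (l j + 1 + 1) * e) + kCd l * e := by
        gcongr
        refine (hC ι c hc).trans ?_
        gcongr with j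
        exact Rint_pert j (l j + 1) f q hfm hqc.measurable
    _ = C * ∑ j, Rint j (l j + 1) 1 f + M * e := by
        rw [Finset.sum_add_distrib, ← Finset.sum_mul, hM]
        push_cast
        ring
    _ ≤ C * ∑ j, Rint j (l j + 1) 1 f + M * ((ε / M : ℝ≥0) : ℝ≥0∞) := by gcongr
    _ = _ := by
        rw [← ENNReal.coe_mul, mul_div_cancel₀ _ hM0.ne']

end NBExt

namespace NBExt

lemma dif_poly (k : ℕ) (ξ : ℝ) (q : Polynomial ℝ) (hq : q.natDegree < k) (x : ℝ) :
    dif k ξ (fun t => q.eval t) x = 0 := by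
  have h := Polynomial.fwdDiff_iter_eq_zero_of_degree_lt (P := q.comp (Polynomial.C x + Polynomial.C ξ * Polynomial.X)) (n := k) (by
    refine lt_of_le_of_lt Polynomial.natDegree_comp_le ?_
    have : (Polynomial.C x + Polynomial.C ξ * Polynomial.X).natDegree ≤ 1 := by compute_degree
    calc _ ≤ q.natDegree * 1 := Nat.mul_le_mul_left _ this
      _ < k := by simpa using hq)
  have h2 := congrFun h 0
  rw [fwdDiff_iter_eq_sum_shift] at h2
  rw [dif]
  simp only [Pi.zero_apply] at h2
  rw [← h2]
  refine Finset.sum_congr rfl fun i _ => ?_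
  rw [Polynomial.eval_comp]
  simp only [Polynomial.eval_add, Polynomial.eval_C, Polynomial.eval_mul, Polynomial.eval_X, zsmul_eq_mul,
    zero_add, nsmul_eq_mul, mul_one]
  rw [mul_comm (i:ℝ) ξ]
  push_cast
  ring

lemma poly_slice {d : ℕ} (l : Fin d → ℕ) (g : (Fin d → ℝ) → ℝ) (hg : IsPolyDeg l g) (j : Fin d)
    (x : Fin d → ℝ) : ∃ q : Polynomial ℝ, q.natDegree ≤ l j ∧ ∀ t, g (update x j t) = q.eval t := by
  obtain ⟨a, ha⟩ := hg
  refine ⟨∑ k : (∀ j : Fin d, Fin (l j + 1)),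
    Polynomial.C (a k * ∏ i ∈ Finset.univ.erase j, x i ^ (k i : ℕ)) * Polynomial.X ^ (k j : ℕ), ?_, ?_⟩
  · refine Polynomial.natDegree_sum_le_of_forall_le _ _ fun k _ => ?_
    refine (Polynomial.natDegree_C_mul_X_pow_le _ _).trans ?_
    have := (k j).2; omega
  · intro t
    rw [ha, Polynomial.eval_finsetSum]
    refine Finset.sum_congr rfl fun k _ => ?_
    rw [← Finset.mul_prod_erase _ _ (Finset.mem_univ j)]
    simp only [update_self, Polynomial.eval_mul, Polynomial.eval_C, Polynomial.eval_pow, Polynomial.eval_X]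
    have : ∏ i ∈ Finset.univ.erase j, update x j t i ^ (k i : ℕ) =
        ∏ i ∈ Finset.univ.erase j, x i ^ (k i : ℕ) :=
      Finset.prod_congr rfl fun i hi => by rw [update_of_ne (Finset.ne_of_mem_erase hi)]
    rw [this]; ring

lemma difj_sub_poly {d : ℕ} (l : Fin d → ℕ) (f g : (Fin d → ℝ) → ℝ) (hg : IsPolyDeg l g) (j : Fin d)
    (ξ : ℝ) (x : Fin d → ℝ) :
    difj j (l j + 1) ξ (fun x => f x - g x) x = difj j (l j + 1) ξ f x := by
  obtain ⟨q, hq, hq2⟩ := poly_slice l g hg j x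
  have h := dif_poly (l j + 1) ξ q (by omega) (x j)
  unfold difj
  have h2 : dif (l j + 1) ξ (fun t => f (update x j t) - g (update x j t)) (x j) =
    dif (l j + 1) ξ (fun t => f (update x j t)) (x j) - dif (l j + 1) ξ (fun t => q.eval t) (x j) := by
    simp only [dif, ← Finset.sum_sub_distrib, hq2, mul_sub]
  rw [h2, h, sub_zero]

/-- constants in the pointwise estimate -/
def cj (k : ℕ) : ℝ≥0 :=
  ∑ i ∈ Finset.range k, (k.choose (i + 1) : ℝ≥0) * Real.toNNReal |(((i : ℝ) + 1) / k)⁻¹|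

lemma pt_est {d : ℕ} (j : Fin d) (k : ℕ) (hk : 0 < k) (g : (Fin d → ℝ) → ℝ) (hg : Measurable g)
    (x : Fin d → ℝ) (hx : x ∈ cub d) :
    ‖g x‖ₑ ≤ (∫⁻ y, ‖difj j k ((y - x j) / k) g x‖ₑ ∂mu1) +
      cj k * ∫⁻ s, ‖g (update x j s)‖ₑ ∂mu1 := by
  have hk' : (0:ℝ) < k := by exact_mod_cast hk
  have h1 : ∀ y : ℝ, ‖g x‖ₑ ≤ ‖difj j k ((y - x j) / k) g x‖ₑ +
      ∑ i ∈ Finset.range k, (k.choose (i + 1) : ℝ≥0∞) *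
        ‖g (update x j (((i : ℝ) + 1) / k * y + x j * (1 - ((i : ℝ) + 1) / k)))‖ₑ := by
    intro y
    have e1 : (-1 : ℝ) ^ k * g x = difj j k ((y - x j) / k) g x -
      ∑ i ∈ Finset.range k, (-1 : ℝ) ^ (k - (i + 1)) * (k.choose (i + 1) : ℝ) *
        g (update x j (((i : ℝ) + 1) / k * y + x j * (1 - ((i : ℝ) + 1) / k))) := by
      unfold difj dif
      rw [Finset.sum_range_succ']
      have : ∀ i : ℕ, x j + ((i + 1 : ℕ) : ℝ) * ((y - x j) / k) =
          ((i : ℝ) + 1) / k * y + x j * (1 - ((i : ℝ) + 1) / k) := by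
        intro i; push_cast; field_simp; ring
      simp only [this]
      simp
    have e2 : ‖g x‖ₑ = ‖(-1 : ℝ) ^ k * g x‖ₑ := by
      simp [enorm_mul, enorm_pow]
    rw [e2, e1]
    refine enorm_sub_le.trans (add_le_add le_rfl ?_)
    refine (enorm_sum_le _ _).trans (Finset.sum_le_sum fun i _ => ?_)
    simp [enorm_mul, enorm_pow]
  have hu : Measurable fun t : ℝ => update x j t := measurable_update x
  have hG : Measurable fun t : ℝ => ‖g (update x j t)‖ₑ := (hg.comp hu).enorm
  have hd : Measurable fun y : ℝ => ‖difj j k ((y - x j) / k) g x‖ₑ :=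
    ((difj_meas2 j k g hg).comp (by fun_prop : Measurable fun y : ℝ => (x, (y - x j) / (k:ℝ)))).enorm
  calc ‖g x‖ₑ = ∫⁻ y, ‖g x‖ₑ ∂mu1 := by simp
    _ ≤ _ := lintegral_mono h1
    _ = _ := lintegral_add_left hd _
    _ ≤ _ := by
      refine add_le_add le_rfl ?_
      have hGi : ∀ i : ℕ, Measurable fun y : ℝ =>
          ‖g (update x j (((i : ℝ) + 1) / k * y + x j * (1 - ((i : ℝ) + 1) / k)))‖ₑ := fun i =>
        hG.comp (by fun_prop : Measurable fun y : ℝ => ((i : ℝ) + 1) / k * y + x j * (1 - ((i : ℝ) + 1) / k))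
      rw [lintegral_finsetSum _ fun i _ => (hGi i).const_mul _, cj,
        ENNReal.ofNNReal_finsetSum, Finset.sum_mul]
      refine Finset.sum_le_sum fun i hi => ?_
      have hi' : ((i:ℝ) + 1) ≤ k := by have := Finset.mem_range.1 hi; exact_mod_cast this
      have hc0 : 0 < ((i:ℝ) + 1) / k := by positivity
      have hc1 : ((i:ℝ) + 1) / k ≤ 1 := by rw [div_le_one hk']; exact hi'
      rw [lintegral_const_mul _ (hGi i)]
      push_cast
      rw [mul_assoc]
      refine mul_le_mul_right ?_ _
      unfold mu1
      refine lint_chg (fun t => ‖g (update x j t)‖ₑ) _ _ hc0.ne' _ _ measurableSet_Ioo measurableSet_Ioo ?_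
      intro y hy
      have hxj := hx j (mem_univ j)
      generalize ((i:ℝ) + 1) / k = c at *
      constructor
      · have := mul_pos hc0 hy.1
        have := mul_nonneg hxj.1.le (sub_nonneg.2 hc1)
        linarith
      · have := mul_lt_mul_of_pos_left hy.2 hc0
        have := mul_le_mul_of_nonneg_right hxj.2.le (sub_nonneg.2 hc1)
        linarith

/-- Hoelder against a constant -/
lemma holder_const {α : Type*} [MeasurableSpace α] (ν : Measure α) (p : ℝ) (hp : 1 ≤ p)
    (h : α → ℝ≥0∞) (hm : AEMeasurable h ν) :
    ∫⁻ x, h x ∂ν ≤ (∫⁻ x, h x ^ p ∂ν) ^ (1 / p) * ν univ ^ (1 - 1 / p) := by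
  have hp0 : 0 < p := by linarith
  have h1 := eLpNorm_le_eLpNorm_mul_rpow_measure_univ (μ := ν) (f := h) (p := 1) (q := ENNReal.ofReal p)
    (by simpa using ENNReal.ofReal_le_ofReal hp) hm.aestronglyMeasurable
  rw [eLpNorm_one_eq_lintegral_enorm, eLpNorm_eq_lintegral_rpow_enorm_toReal (by simpa using hp0) (by simp)] at h1
  simpa [ENNReal.toReal_ofReal hp0.le] using h1

lemma jensen {α : Type*} [MeasurableSpace α] (ν : Measure α) [IsProbabilityMeasure ν] (p : ℝ) (hp : 1 ≤ p)
    (h : α → ℝ≥0∞) (hm : AEMeasurable h ν) :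
    (∫⁻ x, h x ∂ν) ^ p ≤ ∫⁻ x, h x ^ p ∂ν := by
  have hp0 : 0 < p := by linarith
  have := holder_const ν p hp h hm
  simp only [measure_univ, ENNReal.one_rpow, mul_one] at this
  calc _ ≤ ((∫⁻ x, h x ^ p ∂ν) ^ (1 / p)) ^ p := ENNReal.rpow_le_rpow this hp0.le
    _ = _ := by rw [← ENNReal.rpow_mul, one_div_mul_cancel hp0.ne', ENNReal.rpow_one]

/-- the Lp norm on the cube -/
def Np (d : ℕ) (p : ℝ) (H : (Fin d → ℝ) → ℝ≥0∞) : ℝ≥0∞ := (∫⁻ x, H x ^ p ∂mu d) ^ (1 / p)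

lemma Np_add {d : ℕ} (p : ℝ) (hp : 1 ≤ p) (H K : (Fin d → ℝ) → ℝ≥0∞) (hH : Measurable H)
    (hK : Measurable K) : Np d p (fun x => H x + K x) ≤ Np d p H + Np d p K :=
  ENNReal.lintegral_Lp_add_le hH.aemeasurable hK.aemeasurable hp

lemma Np_const_mul {d : ℕ} (p : ℝ) (hp : 1 ≤ p) (c : ℝ≥0) (H : (Fin d → ℝ) → ℝ≥0∞) :
    Np d p (fun x => c * H x) = c * Np d p H := by
  have hp0 : 0 < p := by linarith
  unfold Np
  simp_rw [ENNReal.mul_rpow_of_nonneg _ _ hp0.le]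
  rw [lintegral_const_mul' _ _ (by simp [hp0.le]), ENNReal.mul_rpow_of_nonneg _ _ (by positivity),
    ← ENNReal.rpow_mul, mul_one_div_cancel hp0.ne', ENNReal.rpow_one]

lemma Np_mono {d : ℕ} (p : ℝ) (hp : 1 ≤ p) (H K : (Fin d → ℝ) → ℝ≥0∞) (h : ∀ x ∈ cub d, H x ≤ K x) :
    Np d p H ≤ Np d p K := by
  unfold Np
  refine ENNReal.rpow_le_rpow (lintegral_mono_ae ?_) (by positivity)
  filter_upwards [ae_mu d] with x hx
  exact ENNReal.rpow_le_rpow (h x hx) (by linarith)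

lemma Np_const {d : ℕ} (p : ℝ) (hp : 1 ≤ p) (c : ℝ≥0∞) : Np d p (fun _ => c) = c := by
  unfold Np
  have hp0 : 0 < p := by linarith
  simp [← ENNReal.rpow_mul, mul_inv_cancel₀ hp0.ne']

lemma Np_avg {d : ℕ} (p : ℝ) (hp : 1 ≤ p) (j : Fin d) (H : (Fin d → ℝ) → ℝ≥0∞) (hH : Measurable H) :
    Np d p (fun x => ∫⁻ s, H (update x j s) ∂mu1) ≤ Np d p H := by
  unfold Np
  refine ENNReal.rpow_le_rpow ?_ (by positivity)
  rw [← lint_upd j _ (hH.pow_const p)]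
  refine lintegral_mono fun x => ?_
  exact jensen mu1 p hp _ (hH.comp (measurable_update x)).aemeasurable

lemma D_meas {d : ℕ} (j : Fin d) (k : ℕ) (f : (Fin d → ℝ) → ℝ) (hf : Measurable f) :
    Measurable fun q : (Fin d → ℝ) × ℝ => ‖difj j k ((q.2 - q.1 j) / k) f q.1‖ₑ :=
  ((difj_meas2 j k f hf).comp (by fun_prop : Measurable fun q : (Fin d → ℝ) × ℝ =>
    (q.1, (q.2 - q.1 j) / (k:ℝ)))).enorm

lemma D_est {d : ℕ} (j : Fin d) (k : ℕ) (hk : 0 < k) (p : ℝ) (hp : 1 ≤ p) (f : (Fin d → ℝ) → ℝ)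
    (hf : Measurable f) :
    ∫⁻ x, (∫⁻ y, ‖difj j k ((y - x j) / k) f x‖ₑ ∂mu1) ^ p ∂mu d ≤ k * Rint j k p f := by
  have hk' : (0:ℝ) < k := by exact_mod_cast hk
  have hk1 : (1:ℝ) ≤ k := by exact_mod_cast hk
  have h1 : ∀ x ∈ cub d, (∫⁻ y, ‖difj j k ((y - x j) / k) f x‖ₑ ∂mu1) ^ p ≤
      k * ∫⁻ ξ in Icc (-1:ℝ) 1, Hj j k p f (x, ξ) := by
    intro x hx
    have hxj := hx j (mem_univ j)
    refine (jensen mu1 p hp _ ((D_meas j k f hf).comp (by fun_prop :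
      Measurable fun y : ℝ => (x, y))).aemeasurable).trans ?_
    have h2 : ∫⁻ y, ‖difj j k ((y - x j) / k) f x‖ₑ ^ p ∂mu1 =
        ∫⁻ y in Ioo (0:ℝ) 1, Hj j k p f (x, (1 / k : ℝ) * y + (- x j / k)) := by
      unfold mu1
      refine setLIntegral_congr_fun measurableSet_Ioo fun y hy => ?_
      have e : (1 / k : ℝ) * y + (- x j / k) = (y - x j) / k := by ring
      simp only [e]
      unfold Hj
      rw [indicator_of_mem]
      simp only [Dj, mem_ofPred_eq]
      rw [mul_div_cancel₀ _ hk'.ne']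
      simpa using hy
    refine (le_of_eq h2).trans ?_
    refine (lint_chg (fun ξ => Hj j k p f (x, ξ)) (1 / k : ℝ) (- x j / k) (by positivity) _ (Icc (-1) 1)
      measurableSet_Ioo measurableSet_Icc ?_).trans (le_of_eq ?_)
    · intro y hy
      have e : (1 / k : ℝ) * y + (- x j / k) = (y - x j) / k := by ring
      rw [e]
      have h3 : |y - x j| ≤ 1 := abs_le.2 ⟨by linarith [hy.1, hxj.2], by linarith [hy.2, hxj.1]⟩
      have h4 : |(y - x j) / k| ≤ 1 := by
        rw [abs_div, abs_of_pos hk', div_le_one hk']; linarith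
      exact abs_le.1 h4
    · congr 1
      simp
  refine (lintegral_mono_ae ((ae_mu d).mono h1)).trans (le_of_eq ?_)
  rw [lintegral_const_mul' _ _ (by simp)]
  congr 1
  unfold Rint
  simp_rw [Eint_eq]
  rw [lintegral_lintegral_swap]
  exact (Hj_meas j k p f hf).aemeasurable

end NBExt

namespace NBExt

lemma ind_est {d : ℕ} (C : Fin d → ℝ≥0) (s : Finset (Fin d)) : ∃ M : ℝ≥0, ∀ p : ℝ, 1 ≤ p →
    ∀ (G : (Fin d → ℝ) → ℝ≥0∞) (D : Fin d → (Fin d → ℝ) → ℝ≥0∞), Measurable G → (∀ j, Measurable (D j)) →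
    (∀ j, ∀ x ∈ cub d, G x ≤ D j x + C j * ∫⁻ s, G (update x j s) ∂mu1) →
    ∃ H : (Fin d → ℝ) → ℝ≥0∞, Measurable H ∧ Np d p H ≤ M * ∑ j ∈ s, Np d p (D j) ∧
      ∀ x ∈ cub d, G x ≤ H x + M * lmarginal (fun _ => mu1) s G x := by
  induction s using Finset.induction_on with
  | empty =>
    refine ⟨1, fun p hp G D hG hD h => ⟨fun _ => 0, measurable_const, ?_, fun x _ => by simp⟩⟩
    rw [Np_const p hp]; exact zero_le
  | insert j s hj ih =>
    obtain ⟨M, hM⟩ := ih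
    refine ⟨1 + C j * M, fun p hp G D hG hD h => ?_⟩
    obtain ⟨H, hH, hH1, hH2⟩ := hM p hp G D hG hD h
    have hA : Measurable fun x => ∫⁻ s, H (update x j s) ∂mu1 :=
      Measurable.lintegral_prod_right' (f := fun q : (Fin d → ℝ) × ℝ => H (update q.1 j q.2))
        (hH.comp (measurable_update' (a := j)))
    refine ⟨fun x => D j x + C j * ∫⁻ s, H (update x j s) ∂mu1, (hD j).add (hA.const_mul _), ?_, ?_⟩
    · refine (Np_add p hp _ _ (hD j) (hA.const_mul _)).trans ?_
      rw [Np_const_mul p hp, Finset.sum_insert hj]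
      have h1 : Np d p (fun x => ∫⁻ s, H (update x j s) ∂mu1) ≤ M * ∑ i ∈ s, Np d p (D i) :=
        (Np_avg p hp j H hH).trans hH1
      push_cast
      calc _ ≤ Np d p (D j) + C j * (M * ∑ i ∈ s, Np d p (D i)) := by gcongr
        _ ≤ 1 * Np d p (D j) + (C j * M) * Np d p (D j) + (1 * ∑ i ∈ s, Np d p (D i) +
              C j * M * ∑ i ∈ s, Np d p (D i)) := by
            rw [one_mul, ← mul_assoc]
            exact add_le_add le_self_add le_add_self
        _ = _ := by ring
    · intro x hx
      have h1 : ∫⁻ t, G (update x j t) ∂mu1 ≤ (∫⁻ t, H (update x j t) ∂mu1) +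
          M * lmarginal (fun _ => mu1) (insert j s) G x := by
        have hHu : Measurable fun t => H (update x j t) := hH.comp (measurable_update x)
        rw [lmarginal_insert _ hG hj, ← lintegral_const_mul' _ _ ENNReal.coe_ne_top,
          ← lintegral_add_left hHu]
        unfold mu1
        refine setLIntegral_mono_ae' measurableSet_Ioo (Filter.Eventually.of_forall fun t ht => ?_)
        exact hH2 _ (upd_cub j x hx t ht)
      refine (h j x hx).trans ?_
      rw [add_assoc]
      refine add_le_add le_rfl ?_
      refine (mul_le_mul_right h1 _).trans ?_
      rw [mul_add]
      refine add_le_add le_rfl ?_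
      rw [← mul_assoc]
      refine mul_le_mul_left ?_ _
      push_cast
      exact le_add_self

lemma Rint_one_le {d : ℕ} (j : Fin d) (k : ℕ) (p : ℝ) (hp : 1 ≤ p) (f : (Fin d → ℝ) → ℝ)
    (hf : Measurable f) : Rint j k 1 f ≤ 2 * (Rint j k p f) ^ (1 / p) := by
  have hp0 : 0 < p := by linarith
  have hm := Hj_meas j k 1 f hf
  have hE : Measurable fun ξ => Eint j k 1 ξ f := by
    simp_rw [Eint_eq]
    exact hm.lintegral_prod_left'
  have h1 : ∀ ξ, (Eint j k 1 ξ f) ^ p ≤ Eint j k p ξ f := by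
    intro ξ
    rw [Eint_eq, Eint_eq]
    refine (jensen (mu d) p hp _ (hm.comp (by fun_prop : Measurable fun x : Fin d → ℝ => (x, ξ))).aemeasurable).trans
      (le_of_eq ?_)
    refine lintegral_congr fun x => ?_
    simp only [comp, Hj, indicator]
    split_ifs
    · simp
    · simp [hp0]
  unfold Rint
  refine (holder_const _ p hp _ hE.aemeasurable).trans ?_
  rw [mul_comm]
  refine mul_le_mul' ?_ (ENNReal.rpow_le_rpow (lintegral_mono h1) (by positivity))
  simp only [MeasurableSet.univ, Measure.restrict_apply, univ_inter, Real.volume_Icc]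
  have h2 : ENNReal.ofReal (1 - -1) = 2 := by norm_num
  rw [h2]
  calc (2:ℝ≥0∞) ^ (1 - 1 / p) ≤ 2 ^ (1:ℝ) := by
        refine ENNReal.rpow_le_rpow_of_exponent_le (by norm_num) ?_
        have : 0 < 1 / p := by positivity
        linarith
    _ = 2 := by simp

lemma cube_est_meas {d : ℕ} (j0 : Fin d) (l : Fin d → ℕ) : ∃ C : ℝ≥0, ∀ p : ℝ, 1 ≤ p →
    ∀ f : (Fin d → ℝ) → ℝ, Measurable f → Integrable f (mu d) →
    Np d p (fun x => ‖f x - Kop l f x‖ₑ) ≤ C * ∑ j, (Rint j (l j + 1) p f) ^ (1 / p) := by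
  obtain ⟨C1, hC1⟩ := l1_est j0 l
  obtain ⟨M, hM⟩ := ind_est (fun j => cj (l j + 1)) (Finset.univ : Finset (Fin d))
  refine ⟨M * (∑ j, ((l j + 1 : ℕ) : ℝ≥0)) + M * (C1 * 2), fun p hp f hf hfi => ?_⟩
  have hp0 : 0 < p := by linarith
  have hK : IsPolyDeg l (Kop l f) := Kop_poly l f hfi
  have hg : Measurable fun x => f x - Kop l f x := hf.sub (poly_cont l _ hK).measurable
  have hD : ∀ j, Measurable fun x : Fin d → ℝ =>
      ∫⁻ y, ‖difj j (l j + 1) ((y - x j) / ((l j + 1 : ℕ) : ℝ)) f x‖ₑ ∂mu1 :=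
    fun j => (D_meas j (l j + 1) f hf).lintegral_prod_right
  obtain ⟨H, hH, hH1, hH2⟩ := hM p hp (fun x => ‖f x - Kop l f x‖ₑ) _ hg.enorm hD (by
    intro j x hx
    have := pt_est j (l j + 1) (by omega) _ hg x hx
    simp_rw [difj_sub_poly l f _ hK j] at this
    exact this)
  rw [lmarginal_univ] at hH2
  have hS : ∀ j, Np d p (fun x : Fin d → ℝ =>
      ∫⁻ y, ‖difj j (l j + 1) ((y - x j) / ((l j + 1 : ℕ) : ℝ)) f x‖ₑ ∂mu1) ≤
      ((l j + 1 : ℕ) : ℝ≥0∞) * (Rint j (l j + 1) p f) ^ (1 / p) := by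
    intro j
    refine (ENNReal.rpow_le_rpow (D_est j (l j + 1) (by omega) p hp f hf) (by positivity)).trans ?_
    rw [ENNReal.mul_rpow_of_nonneg _ _ (by positivity)]
    refine mul_le_mul_left ?_ _
    calc (((l j + 1 : ℕ) : ℝ≥0∞)) ^ (1 / p) ≤ ((l j + 1 : ℕ) : ℝ≥0∞) ^ (1:ℝ) := by
          refine ENNReal.rpow_le_rpow_of_exponent_le ?_ ?_
          · exact_mod_cast (by omega : 1 ≤ l j + 1)
          · rw [div_le_one hp0]; exact hp
      _ = _ := by simp
  have hI : ∫⁻ x, ‖f x - Kop l f x‖ₑ ∂mu d ≤ C1 * (2 * ∑ j, (Rint j (l j + 1) p f) ^ (1 / p)) := by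
    refine (hC1 f hf hfi).trans (mul_le_mul_right ?_ _)
    rw [Finset.mul_sum]
    exact Finset.sum_le_sum fun j _ => Rint_one_le j _ p hp f hf
  refine (Np_mono p hp _ _ hH2).trans ?_
  refine (Np_add p hp _ _ hH measurable_const).trans ?_
  rw [Np_const p hp]
  push_cast
  rw [add_mul]
  refine add_le_add (hH1.trans ?_) ?_
  · rw [mul_assoc]
    refine mul_le_mul_right ?_ _
    rw [Finset.sum_mul]
    refine Finset.sum_le_sum fun j _ => (hS j).trans ?_
    push_cast
    refine mul_le_mul_right ?_ _
    exact Finset.single_le_sum (f := fun j => (Rint j (l j + 1) p f) ^ (1 / p)) (fun _ _ => zero_le)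
      (Finset.mem_univ j)
  · rw [mul_assoc]
    refine mul_le_mul_right (hI.trans (le_of_eq ?_)) _
    ring

lemma Kop_congr {d : ℕ} (l : Fin d → ℕ) (f g : (Fin d → ℝ) → ℝ) (h : f =ᵐ[mu d] g) :
    Kop l f = Kop l g := by
  funext x
  unfold Kop
  refine integral_congr_ae ?_
  filter_upwards [h] with y hy
  rw [hy]

lemma cube_est {d : ℕ} (j0 : Fin d) (l : Fin d → ℕ) : ∃ C : ℝ≥0, ∀ p : ℝ, 1 ≤ p →
    ∀ f : (Fin d → ℝ) → ℝ, Integrable f (mu d) →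
    eLpNorm (fun x => f x - Kop l f x) (ENNReal.ofReal p) (mu d) ≤
      C * ∑ j, (Rint j (l j + 1) p f) ^ (1 / p) := by
  obtain ⟨C, hC⟩ := cube_est_meas j0 l
  refine ⟨C, fun p hp f hf => ?_⟩
  have hp0 : 0 < p := by linarith
  obtain ⟨g, hg, hfg⟩ := hf.aestronglyMeasurable
  have h1 := hC p hp g hg.measurable (hf.congr hfg)
  have h2 : ∀ j, Rint j (l j + 1) p f = Rint j (l j + 1) p g := fun j => by
    unfold Rint
    refine lintegral_congr fun ξ => Eint_congr j _ p ξ f g hfg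
  simp_rw [h2]
  refine le_trans (le_of_eq ?_) h1
  rw [eLpNorm_eq_lintegral_rpow_enorm_toReal (by simpa using hp0) (by simp), ENNReal.toReal_ofReal hp0.le]
  unfold Np
  congr 1
  refine lintegral_congr_ae ?_
  filter_upwards [hfg] with x hx
  rw [hx, Kop_congr l f g hfg]

lemma cube_bdd {d : ℕ} (l : Fin d → ℕ) (p : ℝ≥0∞) (hp : 1 ≤ p) (f : (Fin d → ℝ) → ℝ)
    (hf : Integrable f (mu d)) :
    eLpNorm (Kop l f) p (mu d) ≤ kCd l * eLpNorm f p (mu d) := by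
  have h1 : ∫⁻ x, ‖f x‖ₑ ∂mu d ≤ eLpNorm f p (mu d) := by
    rw [← eLpNorm_one_eq_lintegral_enorm]
    exact eLpNorm_le_eLpNorm_of_exponent_le hp hf.aestronglyMeasurable
  have h2 : ∀ᵐ x ∂mu d, ‖Kop l f x‖ₑ ≤ kCd l * ∫⁻ x, ‖f x‖ₑ ∂mu d :=
    (ae_mu d).mono fun x hx => Kop_bound l f x hx
  refine (eLpNorm_le_of_ae_enorm_bound h2).trans ?_
  simp only [measure_univ, ENNReal.one_rpow, smul_eq_mul, mul_one]
  exact mul_le_mul_right h1 _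

end NBExt

namespace NBExt

lemma Kop_repro {d : ℕ} (l : Fin d → ℕ) (g : (Fin d → ℝ) → ℝ) (hg : IsPolyDeg l g) : Kop l g = g := by
  obtain ⟨a, ha⟩ := hg
  funext x
  rw [ha x, funext ha]
  change ∫ y, kerd l x y * (∑ k : (∀ j : Fin d, Fin (l j + 1)), a k * ∏ j, y j ^ (k j : ℕ)) ∂mu d = _
  simp_rw [Finset.mul_sum]
  rw [integral_finsetSum]
  · refine Finset.sum_congr rfl fun k _ => ?_
    have h1 : ∀ y : Fin d → ℝ, kerd l x y * (a k * ∏ j, y j ^ (k j : ℕ)) =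
        a k * ∏ j, (ker1 (l j) (x j) (y j) * y j ^ (k j : ℕ)) := by
      intro y
      rw [Finset.prod_mul_distrib]; unfold kerd; ring
    simp_rw [h1]
    rw [integral_const_mul]
    congr 1
    unfold mu
    rw [integral_fintype_prod_eq_prod (fun i s => ker1 (l i) (x i) s * s ^ (k i : ℕ))]
    refine Finset.prod_congr rfl fun j _ => ?_
    exact ker1_repro (l j) (k j) (by have := (k j).2; omega) (x j)
  · intro k _
    exact int_cont_mul _ _ (kerd_cont_right l x) (cont_int _ (by fun_prop))

lemma Kop_add {d : ℕ} (l : Fin d → ℕ) (f g : (Fin d → ℝ) → ℝ) (hf : Integrable f (mu d))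
    (hg : Integrable g (mu d)) (x : Fin d → ℝ) :
    Kop l (fun y => f y + g y) x = Kop l f x + Kop l g x := by
  change ∫ y, kerd l x y * (f y + g y) ∂mu d =
    (∫ y, kerd l x y * f y ∂mu d) + ∫ y, kerd l x y * g y ∂mu d
  rw [← integral_add (int_cont_mul _ f (kerd_cont_right l x) hf)
    (int_cont_mul _ g (kerd_cont_right l x) hg)]
  congr 1; funext y; ring

lemma Kop_smul {d : ℕ} (l : Fin d → ℕ) (c : ℝ) (f : (Fin d → ℝ) → ℝ) (x : Fin d → ℝ) :
    Kop l (fun y => c * f y) x = c * Kop l f x := by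
  change ∫ y, kerd l x y * (c * f y) ∂mu d = c * (∫ y, kerd l x y * f y ∂mu d)
  rw [← integral_const_mul]
  congr 1; funext y; ring

lemma Kop_adj {d : ℕ} (l : Fin d → ℕ) (f g : (Fin d → ℝ) → ℝ) (hf : Integrable f (mu d))
    (hg : Integrable g (mu d)) :
    ∫ x, Kop l f x * g x ∂mu d = ∫ y, f y * Kop l g y ∂mu d := by
  have hi : Integrable (fun q : (Fin d → ℝ) × (Fin d → ℝ) => kerd l q.1 q.2 * (g q.1 * f q.2))
      ((mu d).prod (mu d)) := by
    refine (hg.mul_prod hf).bdd_mul (c := kCd l) (kerd_cont l).aestronglyMeasurable ?_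
    have h1 : ∀ᵐ q ∂(mu d).prod (mu d), q ∈ cub d ×ˢ cub d := by
      rw [mu_eq, Measure.prod_restrict]
      exact ae_restrict_mem ((cub_meas d).prod (cub_meas d))
    filter_upwards [h1] with q hq
    have := kerd_bound l q.1 q.2 hq.1 hq.2
    rw [enorm_eq_nnnorm] at this
    exact_mod_cast this
  have e1 : ∫ x, Kop l f x * g x ∂mu d = ∫ x, ∫ y, kerd l x y * (g x * f y) ∂mu d ∂mu d := by
    congr 1; funext x
    change (∫ y, kerd l x y * f y ∂mu d) * g x = _
    rw [← integral_mul_const]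
    congr 1; funext y; ring
  have e2 : ∫ y, f y * Kop l g y ∂mu d = ∫ y, ∫ x, kerd l x y * (g x * f y) ∂mu d ∂mu d := by
    congr 1; funext y
    change f y * (∫ x, kerd l y x * g x ∂mu d) = _
    rw [← integral_const_mul]
    congr 1; funext x; rw [kerd_symm l y x]; ring
  rw [e1, e2]
  exact integral_integral_swap hi

lemma kerd_poly {d : ℕ} (l : Fin d → ℕ) (x : Fin d → ℝ) : IsPolyDeg l fun y => kerd l x y := by
  refine ⟨fun k => ∏ j, ∑ m : Fin (l j + 1), kerA (l j) (k j) m * x j ^ (m : ℕ), fun y => ?_⟩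
  simp only
  rw [kerd_symm, kerd_expand]

lemma Kop_ker {d : ℕ} (l : Fin d → ℕ) (f : (Fin d → ℝ) → ℝ) (hf : Integrable f (mu d)) :
    Kop l f = 0 ↔ ∀ g, IsPolyDeg l g → ∫ x, f x * g x ∂mu d = 0 := by
  constructor
  · intro h g hg
    have := Kop_adj l f g hf (cont_int g (poly_cont l g hg))
    rw [Kop_repro l g hg] at this
    rw [← this, h]; simp
  · intro h
    funext x
    change ∫ y, kerd l x y * f y ∂mu d = 0
    rw [← h _ (kerd_poly l x)]
    congr 1; funext y; ring

lemma poly_add {d : ℕ} (l : Fin d → ℕ) (f g : (Fin d → ℝ) → ℝ) (hf : IsPolyDeg l f) (hg : IsPolyDeg l g) :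
    IsPolyDeg l (fun x => f x + g x) := by
  obtain ⟨a, ha⟩ := hf
  obtain ⟨b, hb⟩ := hg
  refine ⟨fun k => a k + b k, fun x => ?_⟩
  simp only [ha, hb, ← Finset.sum_add_distrib, add_mul]

lemma poly_smul {d : ℕ} (l : Fin d → ℕ) (c : ℝ) (f : (Fin d → ℝ) → ℝ) (hf : IsPolyDeg l f) :
    IsPolyDeg l (fun x => c * f x) := by
  obtain ⟨a, ha⟩ := hf
  refine ⟨fun k => c * a k, fun x => ?_⟩
  simp only [ha, Finset.mul_sum, mul_assoc]

lemma poly_zero {d : ℕ} (l : Fin d → ℕ) : IsPolyDeg l (fun _ : Fin d → ℝ => 0) :=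
  ⟨fun _ => 0, fun x => by simp⟩

lemma poly_sum {d : ℕ} (l : Fin d → ℕ) {ι : Type*} (s : Finset ι) (F : ι → (Fin d → ℝ) → ℝ)
    (h : ∀ i, IsPolyDeg l (F i)) : IsPolyDeg l (fun x => ∑ i ∈ s, F i x) := by
  induction s using Finset.induction_on with
  | empty => simpa using poly_zero l
  | insert i s hi ih =>
    simp_rw [Finset.sum_insert hi]
    exact poly_add l _ _ (h i) ih

lemma aff_expand (l k : ℕ) (hk : k ≤ l) (a b : ℝ) : ∃ c : Fin (l + 1) → ℝ, ∀ t : ℝ,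
    (a * t + b) ^ k = ∑ i : Fin (l + 1), c i * t ^ (i : ℕ) := by
  let q : Polynomial ℝ := (Polynomial.C a * Polynomial.X + Polynomial.C b) ^ k
  have hq : q.natDegree < l + 1 := by
    have h1 : (Polynomial.C a * Polynomial.X + Polynomial.C b).natDegree ≤ 1 := by compute_degree
    have := Polynomial.natDegree_pow_le_of_le k h1
    change q.natDegree ≤ _ at this
    omega
  refine ⟨fun i => q.coeff i, fun t => ?_⟩
  rw [Fin.sum_univ_eq_sum_range (fun i => q.coeff i * t ^ i), ← Polynomial.eval_eq_sum_range' hq t]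
  simp [q]

lemma poly_aff {d : ℕ} (l : Fin d → ℕ) (g : (Fin d → ℝ) → ℝ) (hg : IsPolyDeg l g) (a b : Fin d → ℝ) :
    IsPolyDeg l (fun x => g (fun j => a j * x j + b j)) := by
  obtain ⟨A, hA⟩ := hg
  simp_rw [hA]
  refine poly_sum l _ _ fun k => poly_smul l _ _ ?_
  have h1 : ∀ j, ∃ c : Fin (l j + 1) → ℝ, ∀ t : ℝ,
    (a j * t + b j) ^ (k j : ℕ) = ∑ i : Fin (l j + 1), c i * t ^ (i : ℕ) := fun j =>
      aff_expand (l j) (k j) (by have := (k j).2; omega) (a j) (b j)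
  choose c hc using h1
  refine ⟨fun m => ∏ j, c j (m j), fun x => ?_⟩
  simp_rw [hc]
  rw [Finset.prod_univ_sum, Fintype.piFinset_univ]
  simp_rw [Finset.prod_mul_distrib]

end NBExt

namespace NBExt

/-- coordinatewise affine bijection from the unit cube to a box -/
def Phi {d : ℕ} (x0 δ : Fin d → ℝ) (hδ : ∀ j, 0 < δ j) : (Fin d → ℝ) ≃ᵐ (Fin d → ℝ) where
  toFun y := fun j => δ j * y j + x0 j
  invFun x := fun j => (δ j)⁻¹ * x j + (-(δ j)⁻¹ * x0 j)
  left_inv y := by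
    funext j; have := (hδ j).ne'; field_simp; ring
  right_inv x := by
    funext j; have := (hδ j).ne'; field_simp; ring
  measurable_toFun := by simp only [Equiv.coe_fn_mk]; fun_prop
  measurable_invFun := by simp only [Equiv.coe_fn_symm_mk]; fun_prop

lemma Phi_apply {d : ℕ} (x0 δ : Fin d → ℝ) (hδ : ∀ j, 0 < δ j) (y : Fin d → ℝ) :
    Phi x0 δ hδ y = fun j => δ j * y j + x0 j := rfl

lemma Phi_symm_apply {d : ℕ} (x0 δ : Fin d → ℝ) (hδ : ∀ j, 0 < δ j) (x : Fin d → ℝ) :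
    (Phi x0 δ hδ).symm x = fun j => (δ j)⁻¹ * x j + (-(δ j)⁻¹ * x0 j) := rfl

/-- volume of the box -/
def vo {d : ℕ} (δ : Fin d → ℝ) : ℝ≥0∞ := ∏ j, ENNReal.ofReal (δ j)

lemma vo_ne_top {d : ℕ} (δ : Fin d → ℝ) : vo δ ≠ ∞ := ENNReal.prod_ne_top fun _ _ => ENNReal.ofReal_ne_top

lemma vo_ne_zero {d : ℕ} (δ : Fin d → ℝ) (hδ : ∀ j, 0 < δ j) : vo δ ≠ 0 := by
  unfold vo
  rw [Finset.prod_ne_zero_iff]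
  intro j _
  simpa using hδ j

lemma aff_mu1 (a δ : ℝ) (hδ : 0 < δ) (s : Set ℝ) (hs : MeasurableSet s) :
    ENNReal.ofReal δ * mu1 ((fun y => δ * y + a) ⁻¹' s) = volume.restrict (Ioo a (a + δ)) s := by
  have hm : Measurable fun y : ℝ => δ * y + a := by fun_prop
  unfold mu1
  rw [Measure.restrict_apply (hm hs), Measure.restrict_apply hs]
  have h1 : (fun y => δ * y + a) ⁻¹' s ∩ Ioo 0 1 =
      (fun y => δ * y) ⁻¹' ((fun z => z + a) ⁻¹' (s ∩ Ioo a (a + δ))) := by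
    ext y
    simp only [mem_inter_iff, mem_preimage, mem_Ioo]
    refine and_congr_right fun _ => and_congr ?_ ?_
    · constructor
      · intro h; have := mul_pos hδ h; linarith
      · intro h; by_contra! h2; nlinarith
    · constructor
      · intro h; nlinarith
      · intro h; by_contra! h2; nlinarith
  rw [h1, Real.volume_preimage_mul_left hδ.ne', measure_preimage_add_right, ← mul_assoc,
    ← ENNReal.ofReal_mul hδ.le, abs_of_pos (inv_pos.2 hδ), mul_inv_cancel₀ hδ.ne']
  simp

lemma box_meas {d : ℕ} (x0 δ : Fin d → ℝ) (hδ : ∀ j, 0 < δ j) :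
    volume.restrict (box x0 δ) = vo δ • (mu d).map (Phi x0 δ hδ) := by
  unfold box
  rw [volume_pi, Measure.restrict_pi_pi]
  apply Measure.pi_eq
  intro s hs
  rw [Measure.smul_apply, (Phi x0 δ hδ).map_apply]
  have h1 : (Phi x0 δ hδ) ⁻¹' univ.pi s = univ.pi fun j => (fun y => δ j * y + x0 j) ⁻¹' s j := by
    ext y; simp [Phi_apply]
  rw [h1, mu, Measure.pi_pi, vo, smul_eq_mul, ← Finset.prod_mul_distrib]
  exact Finset.prod_congr rfl fun j _ => aff_mu1 (x0 j) (δ j) (hδ j) (s j) (hs j)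

lemma intOn_iff {d : ℕ} (x0 δ : Fin d → ℝ) (hδ : ∀ j, 0 < δ j) (f : (Fin d → ℝ) → ℝ) :
    IntegrableOn f (box x0 δ) volume ↔ Integrable (fun y => f (Phi x0 δ hδ y)) (mu d) := by
  unfold IntegrableOn
  rw [box_meas x0 δ hδ, integrable_smul_measure (vo_ne_zero δ hδ) (vo_ne_top δ)]
  exact (Phi x0 δ hδ).measurableEmbedding.integrable_map_iff

lemma int_box {d : ℕ} (x0 δ : Fin d → ℝ) (hδ : ∀ j, 0 < δ j) (f : (Fin d → ℝ) → ℝ) :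
    ∫ x in box x0 δ, f x = (vo δ).toReal * ∫ y, f (Phi x0 δ hδ y) ∂mu d := by
  rw [box_meas x0 δ hδ, integral_smul_measure, integral_map_equiv, smul_eq_mul]

lemma lint_box {d : ℕ} (x0 δ : Fin d → ℝ) (hδ : ∀ j, 0 < δ j) (f : (Fin d → ℝ) → ℝ≥0∞) :
    ∫⁻ x in box x0 δ, f x = vo δ * ∫⁻ y, f (Phi x0 δ hδ y) ∂mu d := by
  rw [box_meas x0 δ hδ, lintegral_smul_measure, lintegral_map_equiv, smul_eq_mul]

lemma norm_box {d : ℕ} (x0 δ : Fin d → ℝ) (hδ : ∀ j, 0 < δ j) (f : (Fin d → ℝ) → ℝ) (p : ℝ≥0∞) :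
    eLpNorm f p (volume.restrict (box x0 δ)) =
      vo δ ^ (1 / p).toReal * eLpNorm (fun y => f (Phi x0 δ hδ y)) p (mu d) := by
  rw [box_meas x0 δ hδ, eLpNorm_smul_measure_of_ne_zero (vo_ne_zero δ hδ), smul_eq_mul,
    (Phi x0 δ hδ).measurableEmbedding.eLpNorm_map_measure]
  rfl

/-- the projector on a box -/
def Pbox {d : ℕ} (l : Fin d → ℕ) (x0 δ : Fin d → ℝ) (hδ : ∀ j, 0 < δ j) (f : (Fin d → ℝ) → ℝ)
    (x : Fin d → ℝ) : ℝ :=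
  Kop l (fun y => f (Phi x0 δ hδ y)) ((Phi x0 δ hδ).symm x)

lemma poly_Phi {d : ℕ} (l : Fin d → ℕ) (x0 δ : Fin d → ℝ) (hδ : ∀ j, 0 < δ j) (f : (Fin d → ℝ) → ℝ)
    (hf : IsPolyDeg l f) : IsPolyDeg l (fun y => f (Phi x0 δ hδ y)) := by
  simp_rw [Phi_apply]
  exact poly_aff l f hf δ x0

lemma poly_Phi_symm {d : ℕ} (l : Fin d → ℕ) (x0 δ : Fin d → ℝ) (hδ : ∀ j, 0 < δ j) (f : (Fin d → ℝ) → ℝ)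
    (hf : IsPolyDeg l f) : IsPolyDeg l (fun y => f ((Phi x0 δ hδ).symm y)) := by
  simp_rw [Phi_symm_apply]
  exact poly_aff l f hf _ _

lemma poly_intOn {d : ℕ} (l : Fin d → ℕ) (x0 δ : Fin d → ℝ) (hδ : ∀ j, 0 < δ j) (f : (Fin d → ℝ) → ℝ)
    (hf : IsPolyDeg l f) : IntegrableOn f (box x0 δ) volume := by
  rw [intOn_iff x0 δ hδ]
  exact cont_int _ (poly_cont l _ (poly_Phi l x0 δ hδ f hf))

lemma Pbox_pred {d : ℕ} (l : Fin d → ℕ) (x0 δ : Fin d → ℝ) (hδ : ∀ j, 0 < δ j) :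
    ProjPred l (box x0 δ) (Pbox l x0 δ hδ) := by
  refine ⟨?_, ?_, ?_, ?_, ?_, ?_⟩
  · intro f hf
    exact poly_Phi_symm l x0 δ hδ _ (Kop_poly l _ ((intOn_iff x0 δ hδ f).1 hf))
  · intro f hf
    funext x
    unfold Pbox
    rw [Kop_repro l _ (poly_Phi l x0 δ hδ f hf)]
    simp
  · intro f hf
    have hf' := (intOn_iff x0 δ hδ f).1 hf
    have h1 : Pbox l x0 δ hδ f = 0 ↔ Kop l (fun y => f (Phi x0 δ hδ y)) = 0 := by
      constructor
      · intro h
        funext y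
        have := congrFun h (Phi x0 δ hδ y)
        unfold Pbox at this
        rwa [MeasurableEquiv.symm_apply_apply] at this
      · intro h
        funext x
        unfold Pbox
        rw [h]; rfl
    rw [h1, Kop_ker l _ hf']
    have hv : (vo δ).toReal ≠ 0 := (ENNReal.toReal_pos (vo_ne_zero δ hδ) (vo_ne_top δ)).ne'
    constructor
    · intro h g hg
      rw [int_box x0 δ hδ, h _ (poly_Phi l x0 δ hδ g hg), mul_zero]
    · intro h g hg
      have := h _ (poly_Phi_symm l x0 δ hδ g hg)
      rw [int_box x0 δ hδ] at this
      simpa [hv] using this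
  · intro f g hf hg
    funext x
    exact Kop_add l _ _ ((intOn_iff x0 δ hδ f).1 hf) ((intOn_iff x0 δ hδ g).1 hg) _
  · intro c f hf
    funext x
    exact Kop_smul l c _ _
  · intro f g hf hg h
    funext x
    unfold Pbox
    rw [Kop_congr l (fun y => f (Phi x0 δ hδ y)) (fun y => g (Phi x0 δ hδ y))]
    rw [box_meas x0 δ hδ, Filter.EventuallyEq, Measure.ae_ennreal_smul_measure_iff (vo_ne_zero δ hδ)] at h
    exact (Phi x0 δ hδ).measurableEmbedding.ae_map_iff.1 h

lemma proj_unique {d : ℕ} (l : Fin d → ℕ) (x0 δ : Fin d → ℝ) (hδ : ∀ j, 0 < δ j)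
    (P P' : ((Fin d → ℝ) → ℝ) → ((Fin d → ℝ) → ℝ)) (hP : ProjPred l (box x0 δ) P)
    (hP' : ProjPred l (box x0 δ) P') (f : (Fin d → ℝ) → ℝ) (hf : IntegrableOn f (box x0 δ) volume) :
    P' f = P f := by
  obtain ⟨a1, a2, a3, a4, a5, a6⟩ := hP
  obtain ⟨b1, b2, b3, b4, b5, b6⟩ := hP'
  have hq := a1 f hf
  have hqi := poly_intOn l x0 δ hδ _ hq
  have hni : IntegrableOn ((-1 : ℝ) • P f) (box x0 δ) volume := hqi.smul (-1 : ℝ)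
  have hr : IntegrableOn (f + (-1 : ℝ) • P f) (box x0 δ) volume := hf.add hni
  have h1 : P (f + (-1 : ℝ) • P f) = 0 := by
    rw [a4 _ _ hf hni, a5 _ _ hqi, a2 _ hq]
    funext x; simp
  have h2 : P' (f + (-1 : ℝ) • P f) = 0 := (b3 _ hr).2 ((a3 _ hr).1 h1)
  rw [b4 _ _ hf hni, b5 _ _ hqi, b2 _ hq] at h2
  funext x
  have := congrFun h2 x
  simp at this
  linarith

end NBExt

namespace NBExt

lemma mixedDiff_eq {d : ℕ} (j : Fin d) (k : ℕ) (ξ : ℝ) (f : (Fin d → ℝ) → ℝ) (x : Fin d → ℝ) :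
    mixedDiff (fun i => if i = j then k else 0) (Pi.single j ξ) f x = difj j k ξ f x := by
  unfold mixedDiff difj dif
  have hj : (if j = j then k else 0) = k := if_pos rfl
  refine Finset.sum_bij (fun m _ => ((m j : Fin _) : ℕ)) ?_ ?_ ?_ ?_
  · intro m _
    have := (m j).2
    simp only [if_true] at this
    simpa using this
  · intro m _ m' _ h
    funext i
    apply Fin.ext
    by_cases hi : i = j
    · subst hi; exact h
    · have h1 := (m i).2
      have h2 := (m' i).2
      simp only [if_neg hi] at h1 h2
      omega
  · intro b hb
    refine ⟨fun i => if h : i = j then ⟨b, by simpa [h] using hb⟩ else 0, Finset.mem_univ _, ?_⟩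
    simp
  · intro m _
    have hz : ∀ i, i ≠ j → ((m i : Fin _) : ℕ) = 0 := by
      intro i hi
      have h1 := (m i).2
      simp only [if_neg hi] at h1
      omega
    have e1 : ∑ i, ((if i = j then k else 0) - ((m i : Fin _) : ℕ)) = k - ((m j : Fin _) : ℕ) := by
      rw [Finset.sum_eq_single j]
      · simp
      · intro i _ hi; simp [hi]
      · simp
    have e2 : ∏ i, ((if i = j then k else 0).choose (m i) : ℝ) = (k.choose (m j) : ℝ) := by
      rw [Finset.prod_eq_single j]
      · simp
      · intro i _ hi; rw [hz i hi]; simp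
      · simp
    have e3 : (fun i => x i + ((m i : Fin _) : ℕ) * (Pi.single j ξ : Fin d → ℝ) i) =
        update x j (x j + ((m j : Fin _) : ℕ) * ξ) := by
      funext i
      by_cases hi : i = j
      · subst hi; simp
      · simp [hi]
    rw [e1, e2, e3]

lemma diffDomain_eq {d : ℕ} (x0 δ : Fin d → ℝ) (j : Fin d) (k : ℕ) (ξ : ℝ) :
    diffDomain (box x0 δ) (fun i => if i = j then k else 0) (Pi.single j ξ) =
      {x | x j + k * ξ ∈ Ioo (x0 j) (x0 j + δ j)} ∩ box x0 δ := by
  ext x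
  simp only [diffDomain, mem_inter_iff, mem_ofPred_eq]
  constructor
  · rintro ⟨h1, h2⟩
    refine ⟨?_, h1⟩
    have := h2 (fun _ => 1) (by simp) j (mem_univ j)
    simpa using this
  · rintro ⟨h1, h2⟩
    refine ⟨h2, fun t ht i _ => ?_⟩
    have hi2 := h2 i (mem_univ i)
    by_cases hi : i = j
    · subst hi
      simp only [if_true, Pi.single_eq_same]
      obtain ⟨t0, t1⟩ := ht i
      obtain ⟨p1, p2⟩ := h1
      obtain ⟨q1, q2⟩ := hi2
      generalize x i = X at *
      generalize (k:ℝ) = K at *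
      generalize t i = s at *
      have e : X + s * K * ξ = (1 - s) * X + s * (X + K * ξ) := by ring
      simp only [mem_Ioo]
      rw [e]
      rcases eq_or_lt_of_le t0 with h | h
      · subst h; simp; exact ⟨q1, q2⟩
      · constructor
        · have := mul_lt_mul_of_pos_left p1 h
          have := mul_le_mul_of_nonneg_left q1.le (sub_nonneg.2 t1)
          nlinarith
        · have := mul_lt_mul_of_pos_left p2 h
          have := mul_le_mul_of_nonneg_left q2.le (sub_nonneg.2 t1)
          nlinarith
    · simpa [hi] using hi2

/-- the inner integral on the right hand side -/
def Ibox {d : ℕ} (x0 δ : Fin d → ℝ) (j : Fin d) (k : ℕ) (p : ℝ) (f : (Fin d → ℝ) → ℝ) (ξ : ℝ) : ℝ≥0∞ :=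
  ∫⁻ x in diffDomain (box x0 δ) (fun i => if i = j then k else 0) (Pi.single j ξ),
    (ENNReal.ofReal |mixedDiff (fun i => if i = j then k else 0) (Pi.single j ξ) f x|) ^ p

lemma Ibox_eq {d : ℕ} (x0 δ : Fin d → ℝ) (hδ : ∀ j, 0 < δ j) (j : Fin d) (k : ℕ) (p : ℝ)
    (f : (Fin d → ℝ) → ℝ) (η : ℝ) :
    vo δ * Eint j k p η (fun y => f (Phi x0 δ hδ y)) = Ibox x0 δ j k p f (δ j * η) := by
  unfold Ibox Eint
  have hm : MeasurableSet {x : Fin d → ℝ | x j + k * (δ j * η) ∈ Ioo (x0 j) (x0 j + δ j)} :=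
    (by fun_prop : Measurable fun x : Fin d → ℝ => x j + k * (δ j * η)) measurableSet_Ioo
  rw [diffDomain_eq, ← Measure.restrict_restrict hm, ← lintegral_indicator hm, lint_box x0 δ hδ,
    ← lintegral_indicator (Dj_meas j k η)]
  congr 1
  refine lintegral_congr fun y => ?_
  have h1 : y ∈ Dj j k η ↔ Phi x0 δ hδ y ∈ {x : Fin d → ℝ | x j + k * (δ j * η) ∈ Ioo (x0 j) (x0 j + δ j)} := by
    simp only [Dj, mem_ofPred_eq, Phi_apply, mem_Ioo]
    have hj := hδ j
    have e : δ j * y j + x0 j + k * (δ j * η) = δ j * (y j + k * η) + x0 j := by ring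
    rw [e]
    generalize y j + k * η = z
    refine and_congr ?_ ?_
    · constructor
      · intro h; have := mul_pos hj h; linarith
      · intro h; by_contra! h2; nlinarith
    · constructor
      · intro h; nlinarith
      · intro h; by_contra! h2; nlinarith
  have h2 : difj j k η (fun y => f (Phi x0 δ hδ y)) y = difj j k (δ j * η) f (Phi x0 δ hδ y) := by
    unfold difj dif
    refine Finset.sum_congr rfl fun i _ => ?_
    congr 1
    change f (Phi x0 δ hδ (update y j (y j + i * η))) =
      f (update (Phi x0 δ hδ y) j (Phi x0 δ hδ y j + i * (δ j * η)))
    congr 1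
    funext i'
    simp only [Phi_apply]
    by_cases hi : i' = j
    · subst hi; simp; ring
    · simp [hi]
  by_cases hy : y ∈ Dj j k η
  · rw [indicator_of_mem hy, indicator_of_mem (h1.1 hy), mixedDiff_eq, h2, Real.enorm_eq_ofReal_abs]
  · rw [indicator_of_notMem hy, indicator_of_notMem (fun h => hy (h1.2 h))]

lemma Rbox_le {d : ℕ} (x0 δ : Fin d → ℝ) (hδ : ∀ j, 0 < δ j) (j : Fin d) (k : ℕ) (p : ℝ) (hp : 1 ≤ p)
    (f : (Fin d → ℝ) → ℝ) :
    vo δ ^ (1 / p) * (Rint j k p (fun y => f (Phi x0 δ hδ y))) ^ (1 / p) ≤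
      ENNReal.ofReal (δ j ^ (-1 / p)) * (∫⁻ ξ in Icc (-(δ j)) (δ j), Ibox x0 δ j k p f ξ) ^ (1 / p) := by
  have hp0 : 0 < p := by linarith
  have hj := hδ j
  rw [← ENNReal.mul_rpow_of_nonneg _ _ (by positivity)]
  have h1 : vo δ * Rint j k p (fun y => f (Phi x0 δ hδ y)) ≤
      ENNReal.ofReal (δ j)⁻¹ * ∫⁻ ξ in Icc (-(δ j)) (δ j), Ibox x0 δ j k p f ξ := by
    unfold Rint
    rw [← lintegral_const_mul' _ _ (vo_ne_top δ)]
    simp_rw [Ibox_eq x0 δ hδ]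
    have := lint_chg (Ibox x0 δ j k p f) (δ j) 0 hj.ne' (Icc (-1) 1) (Icc (-(δ j)) (δ j))
      measurableSet_Icc measurableSet_Icc (by
        intro x hx
        rw [add_zero]
        constructor <;> nlinarith [hx.1, hx.2])
    simp only [add_zero] at this
    rwa [abs_of_pos (inv_pos.2 hj)] at this
  refine (ENNReal.rpow_le_rpow h1 (by positivity)).trans (le_of_eq ?_)
  rw [ENNReal.mul_rpow_of_nonneg _ _ (by positivity), ENNReal.ofReal_rpow_of_pos (inv_pos.2 hj)]
  congr 2
  rw [Real.inv_rpow hj.le, ← Real.rpow_neg hj.le]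
  congr 1; ring

theorem statement1 (d : ℕ) (hd : 1 ≤ d) (l : Fin d → ℕ) :
    (∀ δ x0 : Fin d → ℝ, (∀ j, 0 < δ j) →
      ∃ P : ((Fin d → ℝ) → ℝ) → ((Fin d → ℝ) → ℝ),
        ProjPred l (box x0 δ) P ∧
        ∀ P', ProjPred l (box x0 δ) P' →
          ∀ f, IntegrableOn f (box x0 δ) volume → P' f = P f) ∧
    (∃ c₂ : ℝ, 0 < c₂ ∧ ∃ c₃ : ℝ, 0 < c₃ ∧
      ∀ (δ x0 : Fin d → ℝ), (∀ j, 0 < δ j) →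
        ∀ P, ProjPred l (box x0 δ) P →
          (∀ p : ℝ≥0∞, 1 ≤ p → ∀ f, IntegrableOn f (box x0 δ) volume →
            eLpNorm (P f) p (volume.restrict (box x0 δ)) ≤
              ENNReal.ofReal c₂ * eLpNorm f p (volume.restrict (box x0 δ))) ∧
          (∀ p : ℝ, 1 ≤ p → ∀ f, IntegrableOn f (box x0 δ) volume →
            eLpNorm (fun x => f x - P f x) (ENNReal.ofReal p)
                (volume.restrict (box x0 δ)) ≤
              ENNReal.ofReal c₃ *
                ∑ j : Fin d, ENNReal.ofReal ((δ j) ^ (-1 / p)) *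
                  (∫⁻ ξ in Icc (-(δ j)) (δ j),
                    ∫⁻ x in diffDomain (box x0 δ)
                        (fun i => if i = j then l j + 1 else 0) (Pi.single j ξ),
                      (ENNReal.ofReal
                          |mixedDiff (fun i => if i = j then l j + 1 else 0)
                            (Pi.single j ξ) f x|) ^ p) ^ (1 / p))) := by
  refine ⟨fun δ x0 hδ => ⟨Pbox l x0 δ hδ, Pbox_pred l x0 δ hδ, fun P' hP' f hf =>
    proj_unique l x0 δ hδ _ P' (Pbox_pred l x0 δ hδ) hP' f hf⟩, ?_⟩
  obtain ⟨C, hC⟩ := cube_est (⟨0, hd⟩ : Fin d) l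
  refine ⟨(kCd l : ℝ) + 1, by positivity, (C : ℝ) + 1, by positivity, fun δ x0 hδ P hP => ⟨?_, ?_⟩⟩
  · intro p hp f hf
    rw [proj_unique l x0 δ hδ _ P (Pbox_pred l x0 δ hδ) hP f hf, norm_box x0 δ hδ, norm_box x0 δ hδ]
    have h1 : (fun y => Pbox l x0 δ hδ f (Phi x0 δ hδ y)) = Kop l (fun y => f (Phi x0 δ hδ y)) := by
      funext y; unfold Pbox; rw [MeasurableEquiv.symm_apply_apply]
    rw [h1, mul_left_comm]
    refine mul_le_mul_right ((cube_bdd l p hp _ ((intOn_iff x0 δ hδ f).1 hf)).trans ?_) _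
    refine mul_le_mul_left ?_ _
    rw [← ENNReal.ofReal_coe_nnreal]
    exact ENNReal.ofReal_le_ofReal (by linarith)
  · intro p hp f hf
    have hp0 : 0 < p := by linarith
    rw [proj_unique l x0 δ hδ _ P (Pbox_pred l x0 δ hδ) hP f hf, norm_box x0 δ hδ]
    have h1 : (fun y => f (Phi x0 δ hδ y) - Pbox l x0 δ hδ f (Phi x0 δ hδ y)) =
        fun y => f (Phi x0 δ hδ y) - Kop l (fun y => f (Phi x0 δ hδ y)) y := by
      funext y; unfold Pbox; rw [MeasurableEquiv.symm_apply_apply]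
    have h2 : (1 / ENNReal.ofReal p).toReal = 1 / p := by
      rw [ENNReal.toReal_div, ENNReal.toReal_ofReal hp0.le]; simp
    rw [h1, h2]
    refine (mul_le_mul_right (hC p hp _ ((intOn_iff x0 δ hδ f).1 hf)) _).trans ?_
    rw [mul_left_comm, Finset.mul_sum]
    refine mul_le_mul' ?_ (Finset.sum_le_sum fun j _ => Rbox_le x0 δ hδ j (l j + 1) p hp f)
    rw [← ENNReal.ofReal_coe_nnreal]
    exact ENNReal.ofReal_le_ofReal (by linarith)

end NBExt
end
end

section
/- Let ψ⁰ : ℝ → ℝ be the indicator function of the interval (0,1), and for m ≥ 1 define ψ^m(x) = ∫₀¹ ψ^{m−1}(x − y) dy. Then for every integer m ≥ 1 and every x ∈ ℝ, the refinement equation ψ^m(x) = ∑_{μ=0}^{m+1} 2^{−m} binom(m+1, μ) ψ^m(2x − μ) holds; for m = 0 the same identity holds for almost every x ∈ ℝ. -/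
open MeasureTheory Set Function
open scoped ENNReal NNReal BigOperators Classical

noncomputable section

namespace NBExt

lemma bspline_succ_eq (m : ℕ) (x : ℝ) :
    bspline (m + 1) x = ∫ u in (x - 1)..x, bspline m u := by
  have h := intervalIntegral.integral_comp_sub_left (a := 0) (b := 1) (bspline m) x
  simpa [bspline] using h

lemma bspline_ii (m : ℕ) : ∀ a b : ℝ, IntervalIntegrable (bspline m) volume a b := by
  induction m with
  | zero =>
    intro a b
    have h : Integrable (bspline 0) volume := by
      simp only [bspline]
      exact (integrable_indicator_iff measurableSet_Ioo).2 (by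
        simp only [Pi.one_def]
        exact integrableOn_const (by simp))
    exact h.intervalIntegrable
  | succ m ih =>
    have hc : Continuous (bspline (m + 1)) := by
      have h0 : Continuous fun t : ℝ => ∫ u in (0 : ℝ)..t, bspline m u :=
        intervalIntegral.continuous_primitive ih 0
      have h1 : bspline (m + 1) = fun x : ℝ =>
          (∫ u in (0 : ℝ)..x, bspline m u) - ∫ u in (0 : ℝ)..(x - 1), bspline m u := by
        funext x
        rw [bspline_succ_eq, intervalIntegral.integral_interval_sub_left (ih _ _) (ih _ _)]
      rw [h1]
      exact h0.sub (h0.comp (continuous_id.sub continuous_const))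
    intro a b
    exact hc.intervalIntegrable a b

lemma bspline_two (m : ℕ) (c : ℝ) (x : ℝ) :
    IntervalIntegrable (fun u => bspline m (2 * u - c)) volume (x - 1) x ∧
    ∫ u in (x - 1)..x, bspline m (2 * u - c) =
      (1 / 2) * (bspline (m + 1) (2 * x - c) + bspline (m + 1) (2 * x - (c + 1))) := by
  constructor
  · have h := ((bspline_ii m (2 * (x - 1) - c) (2 * x - c)).comp_sub_right c).comp_mul_left
      (c := 2)
    convert h using 1 <;> ring
  · rw [intervalIntegral.integral_comp_mul_sub (bspline m) (two_ne_zero) c,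
      bspline_succ_eq, bspline_succ_eq,
      ← intervalIntegral.integral_add_adjacent_intervals
        (bspline_ii m (2 * (x - 1) - c) (2 * x - c - 1)) (bspline_ii m (2 * x - c - 1) (2 * x - c))]
    have e1 : 2 * x - (c + 1) = 2 * x - c - 1 := by ring
    have e2 : 2 * (x - 1) - c = 2 * x - c - 1 - 1 := by ring
    rw [e1, e2, smul_eq_mul]
    ring

lemma pascal_sum (n : ℕ) (F : ℕ → ℝ) :
    ∑ k ∈ Finset.range (n + 1), (n.choose k : ℝ) * (F k + F (k + 1)) =
      ∑ k ∈ Finset.range (n + 2), ((n + 1).choose k : ℝ) * F k := by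
  rw [Finset.sum_range_succ' _ (n + 1)]
  simp only [Nat.choose_succ_succ, Nat.cast_add, add_mul, mul_add, Finset.sum_add_distrib]
  have h : ∑ k ∈ Finset.range (n + 1), (n.choose k : ℝ) * F k =
      ∑ k ∈ Finset.range (n + 1), (n.choose (k + 1) : ℝ) * F (k + 1) + F 0 := by
    rw [Finset.sum_range_succ' _ n, Finset.sum_range_succ _ n]
    simp
  rw [h]
  simp
  ring

lemma refine_step (m : ℕ)
    (h : ∀ᵐ x : ℝ, bspline m x = ∑ μ ∈ Finset.range (m + 2),
        (((m + 1).choose μ : ℝ) / 2 ^ m) * bspline m (2 * x - (μ : ℝ))) (x : ℝ) :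
    bspline (m + 1) x = ∑ μ ∈ Finset.range (m + 1 + 2),
        (((m + 1 + 1).choose μ : ℝ) / 2 ^ (m + 1)) * bspline (m + 1) (2 * x - (μ : ℝ)) := by
  rw [bspline_succ_eq, intervalIntegral.integral_congr_ae (h.mono fun u hu _ => hu),
    intervalIntegral.integral_finsetSum
      (fun (i : ℕ) _ => (bspline_two m (i : ℝ) x).1.const_mul _)]
  simp only [intervalIntegral.integral_const_mul]
  have hp := pascal_sum (m + 1) (fun k => bspline (m + 1) (2 * x - (k : ℝ)))
  have e : ∑ μ ∈ Finset.range (m + 1 + 2),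
        (((m + 1 + 1).choose μ : ℝ) / 2 ^ (m + 1)) * bspline (m + 1) (2 * x - (μ : ℝ)) =
      (1 / 2 ^ (m + 1)) * ∑ μ ∈ Finset.range (m + 1 + 2),
        ((m + 1 + 1).choose μ : ℝ) * bspline (m + 1) (2 * x - (μ : ℝ)) := by
    rw [Finset.mul_sum]
    exact Finset.sum_congr rfl fun i _ => by ring
  rw [e, ← hp, Finset.mul_sum]
  refine Finset.sum_congr rfl fun i _ => ?_
  rw [(bspline_two m (i : ℝ) x).2, Nat.cast_add, Nat.cast_one, pow_succ]
  ring

lemma refine_zero : ∀ᵐ x : ℝ, bspline 0 x = ∑ μ ∈ Finset.range 2,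
        (((0 + 1).choose μ : ℝ) / 2 ^ (0 : ℕ)) * bspline 0 (2 * x - (μ : ℝ)) := by
  filter_upwards [(measure_eq_zero_iff_ae_notMem).1 (measure_singleton (μ := volume) (1 / 2 : ℝ))]
    with x hx
  have hx' : x ≠ 1 / 2 := hx
  simp only [bspline, Finset.sum_range_succ, Finset.sum_range_zero, Set.indicator_apply,
    Set.mem_Ioo, Pi.one_apply]
  norm_num
  rcases lt_or_gt_of_ne hx' with h | h
  · have h2 : ¬ (1 < 2 * x) := by linarith
    have h1 : 2 * x < 1 := by linarith
    have h3 : x < 1 := by linarith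
    simp [h1, h2, h3]
  · have h1 : ¬ (2 * x < 1) := by linarith
    have h2 : 1 < 2 * x := by linarith
    have h3 : 0 < x := by linarith
    have h4 : 2 * x - 1 < 1 ↔ x < 1 := by constructor <;> intro <;> linarith
    simp [h1, h2, h3, h4]

/-- the refinement equation for cardinal B-splines (property (1.3.2)). -/
theorem statement8 :
    (∀ m : ℕ, 1 ≤ m → ∀ x : ℝ,
      bspline m x = ∑ μ ∈ Finset.range (m + 2),
        (((m + 1).choose μ : ℝ) / 2 ^ m) * bspline m (2 * x - (μ : ℝ))) ∧
    (∀ᵐ x : ℝ, bspline 0 x = ∑ μ ∈ Finset.range 2,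
        (((0 + 1).choose μ : ℝ) / 2 ^ (0 : ℕ)) * bspline 0 (2 * x - (μ : ℝ))) := by
  refine ⟨?_, refine_zero⟩
  intro m hm
  induction m, hm using Nat.le_induction with
  | base => exact refine_step 0 refine_zero
  | succ m _ ih => exact refine_step m (Filter.Eventually.of_forall ih)

end NBExt
end
end
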